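/- arXiv:1201.4033 — 10 statements merged into one kernel-verified Lean document; each statement's English description precedes it below -/
import Mathlib

section
/- Let T : ℝ → ℝ, X : ℝ² → ℝ and Q : ℝ² → ℂ be twice continuously differentiable with T'(t) ≠ 0, X_x(x,t) ≠ 0 and Q(x,t) ≠ 0 for all (x,t). Let f : ℝ² → ℝ and k, g, q, h : ℝ² → ℂ be given coefficient functions, let ũ : ℝ² → ℂ be twice continuously differentiable, and define u(x,t) := Q(x,t)·ũ(X(x,t), T(t)). Define the transformed coefficients (as functions of (x,t)) by f̃ = f·X_x²/T', g̃ = g·|Q|²/T', q̃ = q·|Q|⁴/T', h̃ = (h + i·Q_t/Q + f·Q_xx/Q + k·Q_x/Q)/T', k̃ = (i·X_t + f·X_xx + 2 f·X_x·Q_x/Q + k·X_x)/T'. Then for all (x,t): i u_t + f u_xx + k u_x + g|u|²u + q|u|⁴u + h u = T'(t)·Q(x,t)·[ i ũ_t̃(X,T) + f̃(x,t) ũ_x̃x̃(X,T) + k̃(x,t) ũ_x̃(X,T) + g̃(x,t)|ũ(X,T)|²ũ(X,T) + q̃(x,t)|ũ(X,T)|⁴ũ(X,T) + h̃(x,t)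 ũ(X,T) ]. In particular, if the bracketed expression vanishes identically, then u solves i u_t + f u_xx + k u_x + g|u|²u + q|u|⁴u + h u = 0. -/
open Complex

/-- Partial derivative with respect to the first (space) variable. -/
noncomputable def partialX {E : Type*} [NormedAddCommGroup E] [NormedSpace ℝ E]
    (u : ℝ × ℝ → E) : ℝ × ℝ → E :=
  fun p => deriv (fun y => u (y, p.2)) p.1

/-- Partial derivative with respect to the second (time) variable. -/
noncomputable def partialT {E : Type*} [NormedAddCommGroup E] [NormedSpace ℝ E]
    (u : ℝ × ℝ → E) : ℝ × ℝ → E :=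
  fun p => deriv (fun s => u (p.1, s)) p.2

theorem aux_hasX {E : Type*} [NormedAddCommGroup E] [NormedSpace ℝ E]
    {v : ℝ × ℝ → E} (hv : Differentiable ℝ v) (x t : ℝ) :
    HasDerivAt (fun y => v (y, t)) (partialX v (x, t)) x := by
  have : DifferentiableAt ℝ (fun y => v (y, t)) x := by fun_prop
  exact this.hasDerivAt

theorem aux_hasT {E : Type*} [NormedAddCommGroup E] [NormedSpace ℝ E]
    {v : ℝ × ℝ → E} (hv : Differentiable ℝ v) (x t : ℝ) :
    HasDerivAt (fun s => v (x, s)) (partialT v (x, t)) t := by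
  have : DifferentiableAt ℝ (fun s => v (x, s)) t := by fun_prop
  exact this.hasDerivAt

theorem aux_X_fderiv {E : Type*} [NormedAddCommGroup E] [NormedSpace ℝ E]
    {v : ℝ × ℝ → E} (hv : Differentiable ℝ v) (p : ℝ × ℝ) :
    partialX v p = fderiv ℝ v p (1, 0) := by
  have h1 : HasDerivAt (fun y : ℝ => (y, p.2)) ((1 : ℝ), (0 : ℝ)) p.1 :=
    (hasDerivAt_id p.1).prodMk (hasDerivAt_const p.1 p.2)
  exact ((hv p).hasFDerivAt.comp_hasDerivAt p.1 h1).deriv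

theorem aux_T_fderiv {E : Type*} [NormedAddCommGroup E] [NormedSpace ℝ E]
    {v : ℝ × ℝ → E} (hv : Differentiable ℝ v) (p : ℝ × ℝ) :
    partialT v p = fderiv ℝ v p (0, 1) := by
  have h1 : HasDerivAt (fun y : ℝ => (p.1, y)) ((0 : ℝ), (1 : ℝ)) p.2 :=
    (hasDerivAt_const p.2 p.1).prodMk (hasDerivAt_id p.2)
  exact ((hv p).hasFDerivAt.comp_hasDerivAt p.2 h1).deriv

theorem aux_X_diff {E : Type*} [NormedAddCommGroup E] [NormedSpace ℝ E]
    {v : ℝ × ℝ → E} (hv : ContDiff ℝ 2 v) : Differentiable ℝ (partialX v) := by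
  have h0 : Differentiable ℝ v := hv.differentiable (by norm_num)
  have h1 : partialX v = fun p => fderiv ℝ v p (1, 0) := funext (aux_X_fderiv h0)
  have h2 : ContDiff ℝ 1 (fderiv ℝ v) := hv.fderiv_right (by norm_num)
  have h3 : Differentiable ℝ (fderiv ℝ v) := h2.differentiable (by norm_num)
  rw [h1]
  fun_prop

/-- Chain rule in the space variable. -/
theorem aux_chainX {v : ℝ × ℝ → ℂ} {X : ℝ × ℝ → ℝ} (hv : Differentiable ℝ v)
    (hX : Differentiable ℝ X) (x t c : ℝ) :
    HasDerivAt (fun y => v (X (y, t), c))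
      (((partialX X (x, t) : ℝ) : ℂ) * partialX v (X (x, t), c)) x := by
  have := (aux_hasX hv (X (x, t)) c).scomp x (aux_hasX hX x t)
  simpa [Function.comp_def] using this

/-- Chain rule in the time variable. -/
theorem aux_chainT {v : ℝ × ℝ → ℂ} {X : ℝ × ℝ → ℝ} {T : ℝ → ℝ} (hv : Differentiable ℝ v)
    (hX : Differentiable ℝ X) (hT : Differentiable ℝ T) (x t : ℝ) :
    HasDerivAt (fun s => v (X (x, s), T s))
      (((partialT X (x, t) : ℝ) : ℂ) * partialX v (X (x, t), T t)
        + ((deriv T t : ℝ) : ℂ) * partialT v (X (x, t), T t)) t := by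
  have h1 := (aux_hasT hX x t).prodMk (hT t).hasDerivAt
  have h2 := (hv (X (x, t), T t)).hasFDerivAt.comp_hasDerivAt t h1
  have h3 : (partialT X (x, t), deriv T t)
      = partialT X (x, t) • ((1 : ℝ), (0 : ℝ)) + deriv T t • ((0 : ℝ), (1 : ℝ)) := by
    simp
  rw [h3, map_add, map_smul, map_smul, ← aux_X_fderiv hv, ← aux_T_fderiv hv,
    Complex.real_smul, Complex.real_smul] at h2
  exact h2

/-- The point transformation t̃ = T(t), x̃ = X(x,t), u = Q·ũ is an equivalence
    transformation of the variable coefficient CQNLS family, transforming the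
    coefficients by the stated formulas. -/
theorem equivalence_transformation_CQNLS
    (T : ℝ → ℝ) (X : ℝ × ℝ → ℝ) (Q : ℝ × ℝ → ℂ)
    (hT : ContDiff ℝ 2 T) (hX : ContDiff ℝ 2 X) (hQ : ContDiff ℝ 2 Q)
    (hT' : ∀ t : ℝ, deriv T t ≠ 0) (hXx : ∀ p : ℝ × ℝ, partialX X p ≠ 0)
    (hQ0 : ∀ p : ℝ × ℝ, Q p ≠ 0)
    (f : ℝ × ℝ → ℝ) (k g q h : ℝ × ℝ → ℂ)
    (ut : ℝ × ℝ → ℂ) (hut : ContDiff ℝ 2 ut)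
    (u : ℝ × ℝ → ℂ) (hu : ∀ p : ℝ × ℝ, u p = Q p * ut (X p, T p.2))
    (ft : ℝ × ℝ → ℝ) (hft : ∀ p : ℝ × ℝ, ft p = f p * (partialX X p) ^ 2 / deriv T p.2)
    (gt : ℝ × ℝ → ℂ)
    (hgt : ∀ p : ℝ × ℝ, gt p = g p * (‖Q p‖ : ℂ) ^ 2 / ((deriv T p.2 : ℝ) : ℂ))
    (qt : ℝ × ℝ → ℂ)
    (hqt : ∀ p : ℝ × ℝ, qt p = q p * (‖Q p‖ : ℂ) ^ 4 / ((deriv T p.2 : ℝ) : ℂ))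
    (ht : ℝ × ℝ → ℂ)
    (hht : ∀ p : ℝ × ℝ, ht p =
      (h p + I * partialT Q p / Q p + ((f p : ℝ) : ℂ) * partialX (partialX Q) p / Q p
        + k p * partialX Q p / Q p) / ((deriv T p.2 : ℝ) : ℂ))
    (kt : ℝ × ℝ → ℂ)
    (hkt : ∀ p : ℝ × ℝ, kt p =
      (I * ((partialT X p : ℝ) : ℂ) + ((f p : ℝ) : ℂ) * ((partialX (partialX X) p : ℝ) : ℂ)
        + 2 * ((f p : ℝ) : ℂ) * ((partialX X p : ℝ) : ℂ) * partialX Q p / Q p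
        + k p * ((partialX X p : ℝ) : ℂ)) / ((deriv T p.2 : ℝ) : ℂ))
    (B : ℝ × ℝ → ℂ)
    (hB : ∀ p : ℝ × ℝ, B p =
      I * partialT ut (X p, T p.2) + ((ft p : ℝ) : ℂ) * partialX (partialX ut) (X p, T p.2)
        + kt p * partialX ut (X p, T p.2)
        + gt p * (‖ut (X p, T p.2)‖ : ℂ) ^ 2 * ut (X p, T p.2)
        + qt p * (‖ut (X p, T p.2)‖ : ℂ) ^ 4 * ut (X p, T p.2)
        + ht p * ut (X p, T p.2)) :
    (∀ p : ℝ × ℝ,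
      I * partialT u p + ((f p : ℝ) : ℂ) * partialX (partialX u) p + k p * partialX u p
        + g p * (‖u p‖ : ℂ) ^ 2 * u p + q p * (‖u p‖ : ℂ) ^ 4 * u p + h p * u p
      = ((deriv T p.2 : ℝ) : ℂ) * Q p * B p) ∧
    ((∀ p : ℝ × ℝ, B p = 0) → ∀ p : ℝ × ℝ,
      I * partialT u p + ((f p : ℝ) : ℂ) * partialX (partialX u) p + k p * partialX u p
        + g p * (‖u p‖ : ℂ) ^ 2 * u p + q p * (‖u p‖ : ℂ) ^ 4 * u p + h p * u p = 0) := by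
  have dT : Differentiable ℝ T := hT.differentiable (by norm_num)
  have dX : Differentiable ℝ X := hX.differentiable (by norm_num)
  have dQ : Differentiable ℝ Q := hQ.differentiable (by norm_num)
  have dut : Differentiable ℝ ut := hut.differentiable (by norm_num)
  have hu' : u = fun p => Q p * ut (X p, T p.2) := funext hu
  have huX : partialX u = fun p => partialX Q p * ut (X p, T p.2)
      + Q p * (((partialX X p : ℝ) : ℂ) * partialX ut (X p, T p.2)) := by
    funext ⟨x, t⟩
    rw [hu']
    exact ((aux_hasX dQ x t).mul (aux_chainX dut dX x t (T t))).deriv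
  have huT : ∀ p, partialT u p = partialT Q p * ut (X p, T p.2)
      + Q p * (((partialT X p : ℝ) : ℂ) * partialX ut (X p, T p.2)
        + ((deriv T p.2 : ℝ) : ℂ) * partialT ut (X p, T p.2)) := by
    rintro ⟨x, t⟩
    rw [hu']
    exact ((aux_hasT dQ x t).mul (aux_chainT dut dX dT x t)).deriv
  have huXX : ∀ p, partialX (partialX u) p =
      (partialX (partialX Q) p * ut (X p, T p.2)
        + partialX Q p * (((partialX X p : ℝ) : ℂ) * partialX ut (X p, T p.2)))
      + (partialX Q p * (((partialX X p : ℝ) : ℂ) * partialX ut (X p, T p.2))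
        + Q p * (((partialX (partialX X) p : ℝ) : ℂ) * partialX ut (X p, T p.2)
          + ((partialX X p : ℝ) : ℂ) *
            (((partialX X p : ℝ) : ℂ) * partialX (partialX ut) (X p, T p.2)))) := by
    rintro ⟨x, t⟩
    rw [huX]
    exact (((aux_hasX (aux_X_diff hQ) x t).mul (aux_chainX dut dX x t (T t))).add
      ((aux_hasX dQ x t).mul ((aux_hasX (aux_X_diff hX) x t).ofReal_comp.mul
        (aux_chainX (aux_X_diff hut) dX x t (T t))))).deriv
  have main : ∀ p : ℝ × ℝ,
      I * partialT u p + ((f p : ℝ) : ℂ) * partialX (partialX u) p + k p * partialX u p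
        + g p * (‖u p‖ : ℂ) ^ 2 * u p + q p * (‖u p‖ : ℂ) ^ 4 * u p + h p * u p
      = ((deriv T p.2 : ℝ) : ℂ) * Q p * B p := by
    intro p
    have e1 : ((deriv T p.2 : ℝ) : ℂ) ≠ 0 := by exact_mod_cast hT' p.2
    have e2 := hQ0 p
    rw [huXX, huT, huX, hB, hft, hgt, hqt, hht, hkt, hu, norm_mul]
    push_cast
    field_simp
    ring
  refine ⟨main, fun hz p => ?_⟩
  rw [main p, hz p, mul_zero]
end

section
/- Let k = k₁ + i k₂ where k₁, k₂ : ℝ² → ℝ are continuous, and let g, q, h : ℝ² → ℂ. Let R : ℝ² → (0,∞) and θ : ℝ² → ℝ be twice continuously differentiable satisfying 2 R_x/R + k₁ = 0 and 2 θ_x + k₂ = 0 everywhere, and set Q = R e^{iθ}. If ũ : ℝ² → ℂ is twice continuously differentiable and u := Q ũ, then for all (x,t): i u_t + u_xx + k u_x + g|u|²u + q|u|⁴u + h u = Q [ i ũ_t + ũ_xx + g R²|ũ|²ũ + q R⁴|ũ|⁴ũ + h̃ ũ ], where h̃ = h + i Q_t/Q + Q_xx/Q + k Q_x/Q. Consequently,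 if ũ solves the canonical equation i ũ_t + ũ_xx + g R²|ũ|²ũ + q R⁴|ũ|⁴ũ + h̃ ũ = 0, then u solves i u_t + u_xx + k u_x + g|u|²u + q|u|⁴u + h u = 0, i.e. the first-derivative term k u_x can always be removed by an equivalence transformation. -/
open Complex

/-- A `C^1` function has an `x`-partial derivative. -/
theorem hasDerivAt_sliceX {E : Type*} [NormedAddCommGroup E] [NormedSpace ℝ E]
    {f : ℝ × ℝ → E} (hf : Differentiable ℝ f) (p : ℝ × ℝ) :
    HasDerivAt (fun y => f (y, p.2)) (partialX f p) p.1 := by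
  have : DifferentiableAt ℝ (fun y => f (y, p.2)) p.1 := by fun_prop
  exact this.hasDerivAt

theorem hasDerivAt_sliceT {E : Type*} [NormedAddCommGroup E] [NormedSpace ℝ E]
    {f : ℝ × ℝ → E} (hf : Differentiable ℝ f) (p : ℝ × ℝ) :
    HasDerivAt (fun s => f (p.1, s)) (partialT f p) p.2 := by
  have : DifferentiableAt ℝ (fun s => f (p.1, s)) p.2 := by fun_prop
  exact this.hasDerivAt

theorem differentiable_partialX {E : Type*} [NormedAddCommGroup E] [NormedSpace ℝ E]
    {f : ℝ × ℝ → E} (hf : ContDiff ℝ 2 f) : Differentiable ℝ (partialX f) := by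
  have hd : Differentiable ℝ f := hf.differentiable (by norm_num)
  have e : partialX f = fun p => fderiv ℝ f p (1, 0) := by
    funext p
    have h1 : HasDerivAt (fun y : ℝ => (y, p.2)) ((1 : ℝ), (0 : ℝ)) p.1 :=
      (hasDerivAt_id p.1).prodMk (hasDerivAt_const p.1 p.2)
    have h2 : HasFDerivAt f (fderiv ℝ f p) (p.1, p.2) := (hd p).hasFDerivAt
    exact (h2.comp_hasDerivAt p.1 h1).deriv
  rw [e]
  have h3 : ContDiff ℝ 1 (fderiv ℝ f) := hf.fderiv_right (by norm_num)
  have h4 : Differentiable ℝ (fderiv ℝ f) := h3.differentiable (by norm_num)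
  fun_prop

theorem partialX_mul {f g : ℝ × ℝ → ℂ} (hf : Differentiable ℝ f) (hg : Differentiable ℝ g)
    (p : ℝ × ℝ) :
    partialX (fun p => f p * g p) p = partialX f p * g p + f p * partialX g p :=
  ((hasDerivAt_sliceX hf p).mul (hasDerivAt_sliceX hg p)).deriv

theorem partialT_mul {f g : ℝ × ℝ → ℂ} (hf : Differentiable ℝ f) (hg : Differentiable ℝ g)
    (p : ℝ × ℝ) :
    partialT (fun p => f p * g p) p = partialT f p * g p + f p * partialT g p :=
  ((hasDerivAt_sliceT hf p).mul (hasDerivAt_sliceT hg p)).deriv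

/-- The first-derivative term k u_x can always be removed by an equivalence
    transformation u = R e^{iθ} ũ with 2R_x/R + k₁ = 0 and 2θ_x + k₂ = 0. -/
theorem remove_first_order_term
    (k₁ k₂ : ℝ × ℝ → ℝ) (hk₁ : Continuous k₁) (hk₂ : Continuous k₂)
    (g q h : ℝ × ℝ → ℂ)
    (R : ℝ × ℝ → ℝ) (θ : ℝ × ℝ → ℝ)
    (hR : ContDiff ℝ 2 R) (hθ : ContDiff ℝ 2 θ) (hRpos : ∀ p : ℝ × ℝ, 0 < R p)
    (hcond1 : ∀ p : ℝ × ℝ, 2 * partialX R p / R p + k₁ p = 0)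
    (hcond2 : ∀ p : ℝ × ℝ, 2 * partialX θ p + k₂ p = 0)
    (Q : ℝ × ℝ → ℂ)
    (hQ : ∀ p : ℝ × ℝ, Q p = ((R p : ℝ) : ℂ) * Complex.exp (I * ((θ p : ℝ) : ℂ)))
    (ut : ℝ × ℝ → ℂ) (hut : ContDiff ℝ 2 ut)
    (u : ℝ × ℝ → ℂ) (hu : ∀ p : ℝ × ℝ, u p = Q p * ut p)
    (ht : ℝ × ℝ → ℂ)
    (hht : ∀ p : ℝ × ℝ, ht p =
      h p + I * partialT Q p / Q p + partialX (partialX Q) p / Q p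
        + (((k₁ p : ℝ) : ℂ) + I * ((k₂ p : ℝ) : ℂ)) * partialX Q p / Q p) :
    (∀ p : ℝ × ℝ,
      I * partialT u p + partialX (partialX u) p
        + (((k₁ p : ℝ) : ℂ) + I * ((k₂ p : ℝ) : ℂ)) * partialX u p
        + g p * (‖u p‖ : ℂ) ^ 2 * u p + q p * (‖u p‖ : ℂ) ^ 4 * u p + h p * u p
      = Q p * (I * partialT ut p + partialX (partialX ut) p
          + g p * (((R p) ^ 2 : ℝ) : ℂ) * (‖ut p‖ : ℂ) ^ 2 * ut p
          + q p * (((R p) ^ 4 : ℝ) : ℂ) * (‖ut p‖ : ℂ) ^ 4 * ut p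
          + ht p * ut p)) ∧
    ((∀ p : ℝ × ℝ,
        I * partialT ut p + partialX (partialX ut) p
          + g p * (((R p) ^ 2 : ℝ) : ℂ) * (‖ut p‖ : ℂ) ^ 2 * ut p
          + q p * (((R p) ^ 4 : ℝ) : ℂ) * (‖ut p‖ : ℂ) ^ 4 * ut p
          + ht p * ut p = 0) →
      ∀ p : ℝ × ℝ,
        I * partialT u p + partialX (partialX u) p
          + (((k₁ p : ℝ) : ℂ) + I * ((k₂ p : ℝ) : ℂ)) * partialX u p
          + g p * (‖u p‖ : ℂ) ^ 2 * u p + q p * (‖u p‖ : ℂ) ^ 4 * u p + h p * u p = 0) := by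
  have hQe : Q = fun p => ((R p : ℝ) : ℂ) * Complex.exp (I * ((θ p : ℝ) : ℂ)) := funext hQ
  have hue : u = fun p => Q p * ut p := funext hu
  have hRd : Differentiable ℝ R := hR.differentiable (by norm_num)
  have hθd : Differentiable ℝ θ := hθ.differentiable (by norm_num)
  have hutd : Differentiable ℝ ut := hut.differentiable (by norm_num)
  have hQ2 : ContDiff ℝ 2 Q := by
    have h1 : ContDiff ℝ 2 (fun p => ((R p : ℝ) : ℂ)) := Complex.ofRealCLM.contDiff.comp hR
    have h2 : ContDiff ℝ 2 (fun p => ((θ p : ℝ) : ℂ)) := Complex.ofRealCLM.contDiff.comp hθ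
    rw [hQe]
    exact h1.mul (contDiff_const.mul h2).cexp
  have hQd : Differentiable ℝ Q := hQ2.differentiable (by norm_num)
  have hQ0 : ∀ p, Q p ≠ 0 := by
    intro p
    rw [hQ]
    exact mul_ne_zero (Complex.ofReal_ne_zero.mpr (hRpos p).ne') (Complex.exp_ne_zero _)
  have hQx : ∀ p, 2 * partialX Q p + (((k₁ p : ℝ) : ℂ) + I * ((k₂ p : ℝ) : ℂ)) * Q p = 0 := by
    intro p
    have h1 := (hasDerivAt_sliceX hRd p).ofReal_comp
    have h2 := (((hasDerivAt_sliceX hθd p).ofReal_comp).const_mul I).cexp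
    have h3 : partialX Q p = ((partialX R p : ℝ) : ℂ) * Complex.exp (I * ((θ p : ℝ) : ℂ))
        + (R p : ℂ) * (Complex.exp (I * ((θ p : ℝ) : ℂ)) * (I * ((partialX θ p : ℝ) : ℂ))) := by
      rw [hQe]
      exact (h1.mul h2).deriv
    have c1 : 2 * partialX R p = - k₁ p * R p := by
      have := hcond1 p
      have hp := (hRpos p).ne'
      field_simp at this
      linarith
    have c2 : k₂ p = - (2 * partialX θ p) := by linarith [hcond2 p]
    have c1' : 2 * ((partialX R p : ℝ) : ℂ) = - (k₁ p : ℂ) * (R p : ℂ) := by exact_mod_cast c1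
    rw [h3, hQ p, c2]
    push_cast
    linear_combination Complex.exp (I * ((θ p : ℝ) : ℂ)) * c1'
  have hnorm : ∀ p, ‖u p‖ = R p * ‖ut p‖ := by
    intro p
    rw [hu, hQ, norm_mul, norm_mul, mul_comm I, Complex.norm_exp_ofReal_mul_I, mul_one,
      Complex.norm_real, Real.norm_of_nonneg (hRpos p).le]
  have huT : ∀ p, partialT u p = partialT Q p * ut p + Q p * partialT ut p := by
    rw [hue]; exact partialT_mul hQd hutd
  have huX : ∀ p, partialX u p = partialX Q p * ut p + Q p * partialX ut p := by
    rw [hue]; exact partialX_mul hQd hutd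
  have hQXd := differentiable_partialX hQ2
  have hutXd := differentiable_partialX hut
  have huXX : ∀ p, partialX (partialX u) p = (partialX (partialX Q) p * ut p
      + partialX Q p * partialX ut p) + (partialX Q p * partialX ut p
      + Q p * partialX (partialX ut) p) := by
    intro p
    rw [show partialX u = _ from funext huX]
    exact (((hasDerivAt_sliceX hQXd p).mul (hasDerivAt_sliceX hutd p)).add
      ((hasDerivAt_sliceX hQd p).mul (hasDerivAt_sliceX hutXd p))).deriv
  have main : ∀ p : ℝ × ℝ,
      I * partialT u p + partialX (partialX u) p
        + (((k₁ p : ℝ) : ℂ) + I * ((k₂ p : ℝ) : ℂ)) * partialX u p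
        + g p * (‖u p‖ : ℂ) ^ 2 * u p + q p * (‖u p‖ : ℂ) ^ 4 * u p + h p * u p
      = Q p * (I * partialT ut p + partialX (partialX ut) p
          + g p * (((R p) ^ 2 : ℝ) : ℂ) * (‖ut p‖ : ℂ) ^ 2 * ut p
          + q p * (((R p) ^ 4 : ℝ) : ℂ) * (‖ut p‖ : ℂ) ^ 4 * ut p
          + ht p * ut p) := by
    intro p
    have hh : Q p * ht p = Q p * h p + I * partialT Q p + partialX (partialX Q) p
        + (((k₁ p : ℝ) : ℂ) + I * ((k₂ p : ℝ) : ℂ)) * partialX Q p := by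
      rw [hht]
      have := hQ0 p
      field_simp
    rw [hnorm, huT, huXX, huX, hu]
    push_cast
    linear_combination (- ut p) * hh + partialX ut p * hQx p
  refine ⟨main, fun hz p => ?_⟩
  rw [main p, hz p, mul_zero]
end

section
/- Let q ∈ ℂ, h₁ ∈ ℝ and c ∈ ℝ. If u : ℝ² → ℂ is twice continuously differentiable and satisfies the quintic nonlinear Schrödinger equation i u_t + u_xx + q|u|⁴u + h₁ u = 0 on ℝ², then the conformally transformed function w(x,t) := (1 + c t)^{−1/2} · u( x/(1 + c t), t/(1 + c t) ) · exp( i c ( x²/4 + h₁ t² )/(1 + c t) ) satisfies i w_t + w_xx + q|w|⁴w + h₁ w = 0 on the domain {(x,t) ∈ ℝ² : 1 + c t > 0}. -/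
open Complex

/-- The conformal (pseudo-conformal) symmetry generated by Q₆ of the constant
    coefficient quintic NLS `i u_t + u_xx + q|u|⁴u + h₁ u = 0`. -/
theorem conformal_quintic_nls (q : ℂ) (h₁ c : ℝ)
    (u : ℝ × ℝ → ℂ) (hu : ContDiff ℝ 2 u)
    (heq : ∀ p : ℝ × ℝ,
      I * partialT u p + partialX (partialX u) p
        + q * (‖u p‖ : ℂ) ^ 4 * u p + (h₁ : ℂ) * u p = 0)
    (w : ℝ × ℝ → ℂ)
    (hw : ∀ p : ℝ × ℝ,
      w p = (((1 + c * p.2) ^ (-(1 : ℝ) / 2) : ℝ) : ℂ)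
              * u (p.1 / (1 + c * p.2), p.2 / (1 + c * p.2))
              * Complex.exp (I * ((c * (p.1 ^ 2 / 4 + h₁ * p.2 ^ 2) / (1 + c * p.2) : ℝ) : ℂ))) :
    ∀ p : ℝ × ℝ, 0 < 1 + c * p.2 →
      I * partialT w p + partialX (partialX w) p
        + q * (‖w p‖ : ℂ) ^ 4 * w p + (h₁ : ℂ) * w p = 0 := by
  rintro ⟨x, t⟩ hs
  simp only at hs
  have hud : Differentiable ℝ u := hu.differentiable (by norm_num)
  have hX : partialX u = fun p => fderiv ℝ u p (1, 0) := by
    funext p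
    have h1 : HasDerivAt (fun y : ℝ => ((y, p.2) : ℝ × ℝ)) (1, 0) p.1 :=
      (hasDerivAt_id p.1).prodMk (hasDerivAt_const p.1 p.2)
    exact ((hud p).hasFDerivAt.comp_hasDerivAt p.1 h1).deriv
  have hT : partialT u = fun p => fderiv ℝ u p (0, 1) := by
    funext p
    have h1 : HasDerivAt (fun y : ℝ => ((p.1, y) : ℝ × ℝ)) (0, 1) p.2 :=
      (hasDerivAt_const p.2 p.1).prodMk (hasDerivAt_id p.2)
    exact ((hud p).hasFDerivAt.comp_hasDerivAt p.2 h1).deriv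
  have hXd : Differentiable ℝ (partialX u) := by
    rw [hX]
    have h1 : ContDiff ℝ 1 (fderiv ℝ u) := hu.fderiv_right (by norm_num)
    exact (h1.differentiable (by norm_num)).clm_apply (differentiable_const _)
  have hslice : ∀ y z : ℝ, HasDerivAt (fun y => u (y, z)) (partialX u (y, z)) y := by
    intro y z
    exact ((hud (y, z)).comp y (by fun_prop : DifferentiableAt ℝ (fun y : ℝ => (y, z)) y)).hasDerivAt
  have hslice2 : ∀ y z : ℝ, HasDerivAt (fun y => partialX u (y, z))
      (partialX (partialX u) (y, z)) y := by
    intro y z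
    exact ((hXd (y, z)).comp y (by fun_prop : DifferentiableAt ℝ (fun y : ℝ => (y, z)) y)).hasDerivAt
  have hs0 : 1 + c * t ≠ 0 := hs.ne'
  have hsC : (1 + c * t : ℂ) ≠ 0 := by exact_mod_cast hs0
  have hE : ∀ y : ℝ, HasDerivAt (fun y : ℝ => Complex.exp
      (I * ((c * (y ^ 2 / 4 + h₁ * t ^ 2) / (1 + c * t) : ℝ) : ℂ)))
      (Complex.exp (I * ((c * (y ^ 2 / 4 + h₁ * t ^ 2) / (1 + c * t) : ℝ) : ℂ))
        * (I * ((c * y / (2 * (1 + c * t)) : ℝ) : ℂ))) y := by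
    intro y
    have h1 : HasDerivAt (fun y : ℝ => c * (y ^ 2 / 4 + h₁ * t ^ 2) / (1 + c * t))
        (c * y / (2 * (1 + c * t))) y := by
      have := (((((hasDerivAt_id y).pow 2).div_const 4).add_const (h₁ * t ^ 2)).const_mul c).div_const
        (1 + c * t)
      refine this.congr_deriv ?_
      simp
      field_simp
      ring
    exact (h1.ofReal_comp.const_mul I).cexp
  have hU : ∀ y : ℝ, HasDerivAt (fun y : ℝ => u (y / (1 + c * t), t / (1 + c * t)))
      (((1 / (1 + c * t) : ℝ) : ℂ) * partialX u (y / (1 + c * t), t / (1 + c * t))) y := by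
    intro y
    have := (hslice (y / (1 + c * t)) (t / (1 + c * t))).scomp y
      ((hasDerivAt_id y).div_const (1 + c * t))
    simpa [Function.comp_def] using this
  have hU2 : ∀ y : ℝ, HasDerivAt (fun y : ℝ => partialX u (y / (1 + c * t), t / (1 + c * t)))
      (((1 / (1 + c * t) : ℝ) : ℂ)
        * partialX (partialX u) (y / (1 + c * t), t / (1 + c * t))) y := by
    intro y
    have := (hslice2 (y / (1 + c * t)) (t / (1 + c * t))).scomp y
      ((hasDerivAt_id y).div_const (1 + c * t))
    simpa [Function.comp_def] using this
  have hwx : (fun y => partialX w (y, t)) = fun y =>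
      (((1 + c * t) ^ (-(1 : ℝ) / 2) : ℝ) : ℂ)
      * (((1 / (1 + c * t) : ℝ) : ℂ) * partialX u (y / (1 + c * t), t / (1 + c * t)))
      * Complex.exp (I * ((c * (y ^ 2 / 4 + h₁ * t ^ 2) / (1 + c * t) : ℝ) : ℂ))
      + (((1 + c * t) ^ (-(1 : ℝ) / 2) : ℝ) : ℂ)
      * u (y / (1 + c * t), t / (1 + c * t))
      * (Complex.exp (I * ((c * (y ^ 2 / 4 + h₁ * t ^ 2) / (1 + c * t) : ℝ) : ℂ))
        * (I * ((c * y / (2 * (1 + c * t)) : ℝ) : ℂ))) := by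
    funext y
    have h := ((hU y).const_mul (((1 + c * t) ^ (-(1 : ℝ) / 2) : ℝ) : ℂ)).mul (hE y)
    have h2 : (fun y => w (y, t)) = _ := funext fun y => hw (y, t)
    simp only [partialX, h2]
    exact h.deriv
  have hlin : HasDerivAt (fun y : ℝ => ((c * y / (2 * (1 + c * t)) : ℝ) : ℂ))
      ((c / (2 * (1 + c * t)) : ℝ) : ℂ) x := by
    have := (((hasDerivAt_id x).const_mul c).div_const (2 * (1 + c * t))).ofReal_comp
    simpa using this
  have hwxx := ((((hU2 x).const_mul ((1 / (1 + c * t) : ℝ) : ℂ)).const_mul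
      (((1 + c * t) ^ (-(1 : ℝ) / 2) : ℝ) : ℂ)).mul (hE x)).add
      (((hU x).const_mul (((1 + c * t) ^ (-(1 : ℝ) / 2) : ℝ) : ℂ)).mul
        ((hE x).mul (hlin.const_mul I)))
  have h0x : partialX (partialX w) (x, t) = deriv (fun y => partialX w (y, t)) x := rfl
  have hwxx' := h0x.trans ((congrArg (fun f => deriv f x) hwx).trans hwxx.deriv)
  have hS : HasDerivAt (fun r : ℝ => 1 + c * r) c t := by
    simpa using ((hasDerivAt_id t).const_mul c).const_add 1
  have hA : HasDerivAt (fun r : ℝ => (((1 + c * r) ^ (-(1 : ℝ) / 2) : ℝ) : ℂ))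
      ((-(c / 2) * ((1 + c * t) ^ (-(1 : ℝ) / 2)) / (1 + c * t) : ℝ) : ℂ) t := by
    have := (hS.rpow_const (p := -(1 : ℝ) / 2) (Or.inl hs0))
    refine HasDerivAt.ofReal_comp (this.congr_deriv ?_)
    rw [Real.rpow_sub_one hs0]
    ring
  have hUt : HasDerivAt (fun r : ℝ => u (x / (1 + c * r), r / (1 + c * r)))
      (((-(c * x) / (1 + c * t) ^ 2 : ℝ) : ℂ) * partialX u (x / (1 + c * t), t / (1 + c * t))
       + ((1 / (1 + c * t) ^ 2 : ℝ) : ℂ) * partialT u (x / (1 + c * t), t / (1 + c * t))) t := by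
    have h1 : HasDerivAt (fun r : ℝ => x / (1 + c * r)) (-(c * x) / (1 + c * t) ^ 2) t := by
      refine ((hasDerivAt_const t x).div hS hs0).congr_deriv ?_
      ring
    have h2 : HasDerivAt (fun r : ℝ => r / (1 + c * r)) (1 / (1 + c * t) ^ 2) t := by
      refine ((hasDerivAt_id t).div hS hs0).congr_deriv ?_
      simp
      ring
    have h3 := (hud (x / (1 + c * t), t / (1 + c * t))).hasFDerivAt.comp_hasDerivAt t
      (h1.prodMk h2)
    refine h3.congr_deriv ?_
    rw [hX, hT]
    have h4 : ((-(c * x) / (1 + c * t) ^ 2, 1 / (1 + c * t) ^ 2) : ℝ × ℝ)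
      = (-(c * x) / (1 + c * t) ^ 2) • ((1, 0) : ℝ × ℝ)
        + (1 / (1 + c * t) ^ 2) • ((0, 1) : ℝ × ℝ) := by simp
    rw [h4, map_add, map_smul, map_smul, Complex.real_smul, Complex.real_smul]
  have hEt : HasDerivAt (fun r : ℝ => Complex.exp
      (I * ((c * (x ^ 2 / 4 + h₁ * r ^ 2) / (1 + c * r) : ℝ) : ℂ)))
      (Complex.exp (I * ((c * (x ^ 2 / 4 + h₁ * t ^ 2) / (1 + c * t) : ℝ) : ℂ))
        * (I * (((2 * c * h₁ * t * (1 + c * t) - c ^ 2 * (x ^ 2 / 4 + h₁ * t ^ 2))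
          / (1 + c * t) ^ 2 : ℝ) : ℂ))) t := by
    have h1 : HasDerivAt (fun r : ℝ => c * (x ^ 2 / 4 + h₁ * r ^ 2) / (1 + c * r))
        ((2 * c * h₁ * t * (1 + c * t) - c ^ 2 * (x ^ 2 / 4 + h₁ * t ^ 2))
          / (1 + c * t) ^ 2) t := by
      have := ((((((hasDerivAt_id t).pow 2).const_mul h₁).const_add (x ^ 2 / 4)).const_mul c).div
        hS hs0)
      refine this.congr_deriv ?_
      simp
      ring
    exact (h1.ofReal_comp.const_mul I).cexp
  have h0t : partialT w (x, t) = deriv (fun r => w (x, r)) t := rfl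
  have hwt := h0t.trans ((congrArg (fun f => deriv f t) (funext fun r => hw (x, r))).trans
    ((hA.mul hUt).mul hEt).deriv)
  have hapos : 0 < (1 + c * t) ^ (-(1 : ℝ) / 2) := Real.rpow_pos_of_pos hs _
  have ha4 : ((1 + c * t) ^ (-(1 : ℝ) / 2)) ^ 4 = 1 / (1 + c * t) ^ 2 := by
    rw [← Real.rpow_natCast, ← Real.rpow_mul hs.le]
    norm_num
  have hnorm : ‖w (x, t)‖ ^ 4
      = 1 / (1 + c * t) ^ 2 * ‖u (x / (1 + c * t), t / (1 + c * t))‖ ^ 4 := by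
    rw [hw, norm_mul, norm_mul, mul_comm I, Complex.norm_exp_ofReal_mul_I, Complex.norm_real,
      Real.norm_of_nonneg hapos.le, mul_one, mul_pow, ha4]
  have hnC : (‖w (x, t)‖ : ℂ) ^ 4
      = 1 / (1 + c * t) ^ 2 * (‖u (x / (1 + c * t), t / (1 + c * t))‖ : ℂ) ^ 4 := by
    exact_mod_cast congrArg (fun r : ℝ => (r : ℂ)) hnorm
  have he := heq (x / (1 + c * t), t / (1 + c * t))
  rw [hnC, hwt, hwxx', hw]
  simp only [Pi.mul_apply]
  generalize Complex.exp (I * ((c * (x ^ 2 / 4 + h₁ * t ^ 2) / (1 + c * t) : ℝ) : ℂ)) = E at *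
  push_cast
  generalize (1 + c * t) ^ (-(1 : ℝ) / 2) = a at *
  generalize partialX (partialX u) (x / (1 + c * t), t / (1 + c * t)) = uxx at *
  generalize partialX u (x / (1 + c * t), t / (1 + c * t)) = ux at *
  generalize partialT u (x / (1 + c * t), t / (1 + c * t)) = ut at *
  generalize u (x / (1 + c * t), t / (1 + c * t)) = U at *
  have huxx : uxx = -(I * ut + q * (‖U‖ : ℂ) ^ 4 * U + (h₁ : ℂ) * U) := by
    linear_combination he
  rw [huxx]
  generalize (‖U‖ : ℂ) = N
  clear * - hsC
  have hI : I ^ 2 = -1 := Complex.I_sq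
  field_simp
  ring_nf
  simp only [hI]
  ring
end

section
/- Let a, g₁, g₂, q₁, q₂, h₁, h₂ ∈ ℝ and λ > 0. If u : (0,∞) × ℝ → ℂ is twice continuously differentiable and satisfies i u_t + u_xx + (g₁ + i g₂) x^{−2(2a+1)} |u|²u + (q₁ + i q₂) x^{−2(4a+1)} |u|⁴u + (h₁ + i h₂) x^{−2} u = 0 for all x > 0, t ∈ ℝ, then v(x,t) := λ^{2a} u(x/λ, t/λ²) satisfies the same equation on (0,∞) × ℝ. -/
open Complex

theorem deriv_scale_aux (c : ℂ) (f : ℝ → ℂ) (l x : ℝ) :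
    deriv (fun y => c * f (y / l)) x = c * ((l⁻¹ : ℝ) : ℂ) * deriv f (x / l) := by
  rw [deriv_const_mul_field]
  have h : (fun y => f (y / l)) = fun y => f (l⁻¹ * y) := by
    funext y; rw [div_eq_inv_mul]
  rw [h, deriv_comp_mul_left, Complex.real_smul, div_eq_inv_mul, mul_assoc]

/-- The dilation symmetry generated by Q₃ of the class A¹₃.₂. -/
theorem dilation_A132 (a g₁ g₂ q₁ q₂ h₁ h₂ l : ℝ) (hl : 0 < l)
    (u : ℝ × ℝ → ℂ) (hu : ContDiffOn ℝ 2 u {p : ℝ × ℝ | 0 < p.1})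
    (heq : ∀ p : ℝ × ℝ, 0 < p.1 →
      I * partialT u p + partialX (partialX u) p
        + ((g₁ : ℂ) + I * g₂) * ((p.1 ^ (-(2 * (2 * a + 1)) : ℝ) : ℝ) : ℂ) * (‖u p‖ : ℂ) ^ 2 * u p
        + ((q₁ : ℂ) + I * q₂) * ((p.1 ^ (-(2 * (4 * a + 1)) : ℝ) : ℝ) : ℂ) * (‖u p‖ : ℂ) ^ 4 * u p
        + ((h₁ : ℂ) + I * h₂) * ((p.1 ^ (-2 : ℝ) : ℝ) : ℂ) * u p = 0)
    (v : ℝ × ℝ → ℂ)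
    (hv : ∀ p : ℝ × ℝ, v p = ((l ^ (2 * a) : ℝ) : ℂ) * u (p.1 / l, p.2 / l ^ 2)) :
    ∀ p : ℝ × ℝ, 0 < p.1 →
      I * partialT v p + partialX (partialX v) p
        + ((g₁ : ℂ) + I * g₂) * ((p.1 ^ (-(2 * (2 * a + 1)) : ℝ) : ℝ) : ℂ) * (‖v p‖ : ℂ) ^ 2 * v p
        + ((q₁ : ℂ) + I * q₂) * ((p.1 ^ (-(2 * (4 * a + 1)) : ℝ) : ℝ) : ℂ) * (‖v p‖ : ℂ) ^ 4 * v p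
        + ((h₁ : ℂ) + I * h₂) * ((p.1 ^ (-2 : ℝ) : ℝ) : ℂ) * v p = 0 := by
  intro p hp
  obtain ⟨x, t⟩ := p
  simp only at hp
  have hvx : partialX v = fun p => (((l ^ (2 * a) : ℝ) : ℂ) * ((l⁻¹ : ℝ) : ℂ)) *
      partialX u (p.1 / l, p.2 / l ^ 2) := by
    funext p
    simp only [partialX, hv]
    exact deriv_scale_aux _ (fun y => u (y, p.2 / l ^ 2)) l p.1
  have hvxx : partialX (partialX v) (x, t) = (((l ^ (2 * a) : ℝ) : ℂ) * ((l⁻¹ : ℝ) : ℂ)) *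
      ((l⁻¹ : ℝ) : ℂ) * partialX (partialX u) (x / l, t / l ^ 2) := by
    rw [hvx]
    exact deriv_scale_aux _ (fun y => partialX u (y, t / l ^ 2)) l x
  have hvt : partialT v (x, t) = ((l ^ (2 * a) : ℝ) : ℂ) * (((l ^ 2)⁻¹ : ℝ) : ℂ) *
      partialT u (x / l, t / l ^ 2) := by
    simp only [partialT, hv]
    exact deriv_scale_aux _ (fun s => u (x / l, s)) (l ^ 2) t
  have hy : 0 < x / l := div_pos hp hl
  have key := heq (x / l, t / l ^ 2) hy
  have hL : 0 < l ^ (2 * a) := Real.rpow_pos_of_pos hl _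
  have hx : ∀ k : ℝ, x ^ k = (x / l) ^ k * l ^ k := fun k => by
    rw [← Real.mul_rpow hy.le hl.le, div_mul_cancel₀ _ hl.ne']
  have e0 : l ^ (-2 : ℝ) = (l ^ 2)⁻¹ := by
    rw [Real.rpow_neg hl.le]; norm_num
  have e1 : l ^ (-(2 * (2 * a + 1)) : ℝ) = ((l ^ (2 * a)) ^ 2)⁻¹ * (l ^ 2)⁻¹ := by
    rw [show (-(2 * (2 * a + 1)) : ℝ) = -((2 * a) * (2 : ℕ)) + (-2) by push_cast; ring,
      Real.rpow_add hl, e0, Real.rpow_neg hl.le, Real.rpow_mul_natCast hl.le]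
  have e2 : l ^ (-(2 * (4 * a + 1)) : ℝ) = ((l ^ (2 * a)) ^ 4)⁻¹ * (l ^ 2)⁻¹ := by
    rw [show (-(2 * (4 * a + 1)) : ℝ) = -((2 * a) * (4 : ℕ)) + (-2) by push_cast; ring,
      Real.rpow_add hl, e0, Real.rpow_neg hl.le, Real.rpow_mul_natCast hl.le]
  have hn : ‖v (x, t)‖ = l ^ (2 * a) * ‖u (x / l, t / l ^ 2)‖ := by
    rw [hv, norm_mul, Complex.norm_real, Real.norm_of_nonneg hL.le]
  rw [hn, hvxx, hvt, hv]
  simp only at key ⊢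
  rw [hx (-(2 * (2 * a + 1))), hx (-(2 * (4 * a + 1))), hx (-2), e0, e1, e2]
  generalize l ^ (2 * a) = L at *
  have hLc : (L : ℂ) ≠ 0 := by exact_mod_cast hL.ne'
  have hlc : (l : ℂ) ≠ 0 := by exact_mod_cast hl.ne'
  generalize (x / l) ^ (-(2 * (2 * a + 1))) = A at *
  generalize (x / l) ^ (-(2 * (4 * a + 1))) = B at *
  generalize (x / l) ^ (-2 : ℝ) = C at *
  push_cast
  generalize (‖u (x / l, t / l ^ 2)‖ : ℂ) = N at *
  generalize u (x / l, t / l ^ 2) = U at *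
  generalize partialT u (x / l, t / l ^ 2) = UT at *
  generalize partialX (partialX u) (x / l, t / l ^ 2) = UX at *
  rw [← mul_zero ((L : ℂ) * ((l : ℂ) ^ 2)⁻¹), ← key]
  field_simp
end

section
/- Let a, b, c, g₁, g₂, q₁, q₂ ∈ ℝ and s ∈ ℝ. Consider the equation i u_t + u_xx + (g₁ + i g₂)(t + b)^{−(1+c)} exp( −2 a x/√(t+b) ) |u|²u + (q₁ + i q₂)(t + b)^{−(1+2c)} exp( −4 a x/√(t+b) ) |u|⁴u + i (a x / (2 (t+b)^{3/2})) u = 0 on the domain {(x,t) : t + b > 0}. If u is twice continuously differentiable and satisfies this equation, then v(x,t) := exp( a s/√(t+b) ) · u(x − s, t) satisfies the same equation on the same domain. -/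
open Complex

/-- The symmetry generated by Q₂ = ∂ₓ + (a/√(t+b)) ρ∂_ρ of the class A²₃.₂. -/
theorem translation_A232 (a b c g₁ g₂ q₁ q₂ s : ℝ)
    (u : ℝ × ℝ → ℂ) (hu : ContDiffOn ℝ 2 u {p : ℝ × ℝ | 0 < p.2 + b})
    (heq : ∀ p : ℝ × ℝ, 0 < p.2 + b →
      I * partialT u p + partialX (partialX u) p
        + ((g₁ : ℂ) + I * g₂) * (((p.2 + b) ^ (-(1 + c)) : ℝ) : ℂ)
            * ((Real.exp (-2 * a * p.1 / Real.sqrt (p.2 + b)) : ℝ) : ℂ) * (‖u p‖ : ℂ) ^ 2 * u p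
        + ((q₁ : ℂ) + I * q₂) * (((p.2 + b) ^ (-(1 + 2 * c)) : ℝ) : ℂ)
            * ((Real.exp (-4 * a * p.1 / Real.sqrt (p.2 + b)) : ℝ) : ℂ) * (‖u p‖ : ℂ) ^ 4 * u p
        + I * ((a * p.1 / (2 * (p.2 + b) ^ ((3 : ℝ) / 2)) : ℝ) : ℂ) * u p = 0)
    (v : ℝ × ℝ → ℂ)
    (hv : ∀ p : ℝ × ℝ,
      v p = ((Real.exp (a * s / Real.sqrt (p.2 + b)) : ℝ) : ℂ) * u (p.1 - s, p.2)) :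
    ∀ p : ℝ × ℝ, 0 < p.2 + b →
      I * partialT v p + partialX (partialX v) p
        + ((g₁ : ℂ) + I * g₂) * (((p.2 + b) ^ (-(1 + c)) : ℝ) : ℂ)
            * ((Real.exp (-2 * a * p.1 / Real.sqrt (p.2 + b)) : ℝ) : ℂ) * (‖v p‖ : ℂ) ^ 2 * v p
        + ((q₁ : ℂ) + I * q₂) * (((p.2 + b) ^ (-(1 + 2 * c)) : ℝ) : ℂ)
            * ((Real.exp (-4 * a * p.1 / Real.sqrt (p.2 + b)) : ℝ) : ℂ) * (‖v p‖ : ℂ) ^ 4 * v p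
        + I * ((a * p.1 / (2 * (p.2 + b) ^ ((3 : ℝ) / 2)) : ℝ) : ℂ) * v p = 0 := by
  rintro ⟨x, t⟩ hp
  have hT : 0 < t + b := hp
  have hX : ∀ (w z : ℝ × ℝ → ℂ), (∀ y, z (y, t) = ((Real.exp (a * s / Real.sqrt (t + b)) : ℝ) : ℂ) * w (y - s, t)) →
      ∀ y, partialX z (y, t) = ((Real.exp (a * s / Real.sqrt (t + b)) : ℝ) : ℂ) * partialX w (y - s, t) := by
    intro w z h y
    simp only [partialX, h]
    rw [deriv_const_mul_field]
    congr 1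
    exact deriv_comp_sub_const (f := fun y => w (y, t)) s y
  have h1 := hX u v (fun y => hv (y, t))
  have h2 := hX _ _ h1 x
  have hopen : IsOpen {p : ℝ × ℝ | 0 < p.2 + b} :=
    isOpen_lt continuous_const (continuous_snd.add continuous_const)
  have hd : DifferentiableAt ℝ u (x - s, t) :=
    (hu.differentiableOn (by norm_num)).differentiableAt (hopen.mem_nhds hT)
  have hdt : HasDerivAt (fun r => u (x - s, r)) (partialT u (x - s, t)) t := by
    have : DifferentiableAt ℝ (fun r : ℝ => u (x - s, r)) t :=
      DifferentiableAt.comp (g := u) (f := fun r : ℝ => (x - s, r)) t hd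
        ((differentiableAt_const _).prodMk differentiableAt_id)
    exact this.hasDerivAt
  have hpow : (t + b) ^ ((3 : ℝ) / 2) = (t + b) * Real.sqrt (t + b) := by
    rw [Real.sqrt_eq_rpow, show (3 : ℝ) / 2 = 1 + 1 / 2 by norm_num, Real.rpow_add hT, Real.rpow_one]
  have hs0 : 0 < Real.sqrt (t + b) := Real.sqrt_pos.2 hT
  have hs2 : Real.sqrt (t + b) ^ 2 = t + b := Real.sq_sqrt hT.le
  have hE : HasDerivAt (fun r => Real.exp (a * s / Real.sqrt (r + b)))
      (Real.exp (a * s / Real.sqrt (t + b)) * (-(a * s / (2 * (t + b) ^ ((3 : ℝ) / 2))))) t := by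
    have hq : HasDerivAt (fun r => Real.sqrt (r + b)) (1 / (2 * Real.sqrt (t + b))) t :=
      ((hasDerivAt_id t).add_const b).sqrt hT.ne'
    have := ((hasDerivAt_const t (a * s)).div hq hs0.ne').exp
    refine this.congr_deriv ?_
    simp only [Pi.div_apply]
    rw [hpow, hs2]
    congr 1
    field_simp
    ring
  have h3 : partialT v (x, t) = ((Real.exp (a * s / Real.sqrt (t + b)) *
      (-(a * s / (2 * (t + b) ^ ((3 : ℝ) / 2)))) : ℝ) : ℂ) * u (x - s, t)
      + ((Real.exp (a * s / Real.sqrt (t + b)) : ℝ) : ℂ) * partialT u (x - s, t) := by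
    have := (hE.ofReal_comp.mul hdt).deriv
    simp only [partialT, hv]
    exact this
  have hn : (‖v (x, t)‖ : ℂ) = ((Real.exp (a * s / Real.sqrt (t + b)) : ℝ) : ℂ) * (‖u (x - s, t)‖ : ℂ) := by
    rw [hv, norm_mul, Complex.norm_real, Real.norm_eq_abs, Real.abs_exp, Complex.ofReal_mul]
  have h := heq (x - s, t) hT
  have e2 : Real.exp (-2 * a * (x - s) / Real.sqrt (t + b)) =
      Real.exp (-2 * a * x / Real.sqrt (t + b)) * Real.exp (a * s / Real.sqrt (t + b)) ^ 2 := by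
    rw [← Real.exp_nat_mul, ← Real.exp_add]
    congr 1
    push_cast
    ring
  have e4 : Real.exp (-4 * a * (x - s) / Real.sqrt (t + b)) =
      Real.exp (-4 * a * x / Real.sqrt (t + b)) * Real.exp (a * s / Real.sqrt (t + b)) ^ 4 := by
    rw [← Real.exp_nat_mul, ← Real.exp_add]
    congr 1
    push_cast
    ring
  have e5 : a * (x - s) / (2 * (t + b) ^ ((3 : ℝ) / 2)) =
      a * x / (2 * (t + b) ^ ((3 : ℝ) / 2)) + (-(a * s / (2 * (t + b) ^ ((3 : ℝ) / 2)))) := by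
    ring
  rw [h2, h3, hn, hv]
  simp only [] at h ⊢
  rw [e2, e4, e5] at h
  generalize Real.exp (a * s / Real.sqrt (t + b)) = E at *
  generalize -(a * s / (2 * (t + b) ^ ((3 : ℝ) / 2))) = K at *
  generalize a * x / (2 * (t + b) ^ ((3 : ℝ) / 2)) = L at *
  simp only [Complex.ofReal_mul, Complex.ofReal_add, Complex.ofReal_pow] at h ⊢
  linear_combination (E : ℂ) * h
end

section
/- Let a, b, c, g₁, g₂, q₁, q₂ ∈ ℝ and λ > 0. Consider the equation i u_t + u_xx + (g₁ + i g₂)(t + b)^{−(1+c)} exp( −2 a x/√(t+b) ) |u|²u + (q₁ + i q₂)(t + b)^{−(1+2c)} exp( −4 a x/√(t+b) ) |u|⁴u + i (a x / (2 (t+b)^{3/2})) u = 0 on the domain {(x,t) : t + b > 0}. If u is twice continuously differentiable and satisfies this equation, then v(x,t) := λ^{c} · u( x/λ, (t + b)/λ² − b ) satisfies the same equation on the same domain. -/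
open Complex

theorem deriv_affine_aux (C : ℂ) (f : ℝ → ℂ) (k d x : ℝ) :
    deriv (fun y => C * f (k * y + d)) x = C * ((k : ℂ) * deriv f (k * x + d)) := by
  rw [deriv_const_mul_field]
  have h := deriv_comp_mul_left k (fun z => f (z + d)) x
  rw [h, deriv_comp_add_const]
  simp

theorem rpow_aux (l s c m : ℝ) (hl : 0 < l) (hs : 0 < s) :
    (s / l ^ 2) ^ (-(1 + m * c)) = s ^ (-(1 + m * c)) * l ^ 2 * ((l ^ c) ^ (2 * m)) := by
  rw [Real.div_rpow hs.le (by positivity), div_eq_mul_inv, ← Real.rpow_neg (by positivity),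
    ← Real.rpow_natCast l 2, ← Real.rpow_mul hl.le, ← Real.rpow_mul hl.le, mul_assoc,
    ← Real.rpow_add hl]
  congr 2
  push_cast
  ring

/-- The symmetry generated by Q₃ = x∂ₓ + 2(t+b)∂_t + c ρ∂_ρ (dilation) of the class A²₃.₂. -/
theorem dilation_A232 (a b c g₁ g₂ q₁ q₂ l : ℝ) (hl : 0 < l)
    (u : ℝ × ℝ → ℂ) (hu : ContDiffOn ℝ 2 u {p : ℝ × ℝ | 0 < p.2 + b})
    (heq : ∀ p : ℝ × ℝ, 0 < p.2 + b →
      I * partialT u p + partialX (partialX u) p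
        + ((g₁ : ℂ) + I * g₂) * (((p.2 + b) ^ (-(1 + c)) : ℝ) : ℂ)
            * ((Real.exp (-2 * a * p.1 / Real.sqrt (p.2 + b)) : ℝ) : ℂ) * (‖u p‖ : ℂ) ^ 2 * u p
        + ((q₁ : ℂ) + I * q₂) * (((p.2 + b) ^ (-(1 + 2 * c)) : ℝ) : ℂ)
            * ((Real.exp (-4 * a * p.1 / Real.sqrt (p.2 + b)) : ℝ) : ℂ) * (‖u p‖ : ℂ) ^ 4 * u p
        + I * ((a * p.1 / (2 * (p.2 + b) ^ ((3 : ℝ) / 2)) : ℝ) : ℂ) * u p = 0)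
    (v : ℝ × ℝ → ℂ)
    (hv : ∀ p : ℝ × ℝ,
      v p = ((l ^ c : ℝ) : ℂ) * u (p.1 / l, (p.2 + b) / l ^ 2 - b)) :
    ∀ p : ℝ × ℝ, 0 < p.2 + b →
      I * partialT v p + partialX (partialX v) p
        + ((g₁ : ℂ) + I * g₂) * (((p.2 + b) ^ (-(1 + c)) : ℝ) : ℂ)
            * ((Real.exp (-2 * a * p.1 / Real.sqrt (p.2 + b)) : ℝ) : ℂ) * (‖v p‖ : ℂ) ^ 2 * v p
        + ((q₁ : ℂ) + I * q₂) * (((p.2 + b) ^ (-(1 + 2 * c)) : ℝ) : ℂ)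
            * ((Real.exp (-4 * a * p.1 / Real.sqrt (p.2 + b)) : ℝ) : ℂ) * (‖v p‖ : ℂ) ^ 4 * v p
        + I * ((a * p.1 / (2 * (p.2 + b) ^ ((3 : ℝ) / 2)) : ℝ) : ℂ) * v p = 0 := by
  intro p hp
  obtain ⟨x, t⟩ := p
  simp only at hp
  have hv' : v = fun p : ℝ × ℝ =>
      ((l ^ c : ℝ) : ℂ) * u (p.1 / l, (p.2 + b) / l ^ 2 - b) := funext hv
  have hl0 : l ≠ 0 := hl.ne'
  set T := (t + b) / l ^ 2 - b with hT
  have hTb : T + b = (t + b) / l ^ 2 := by rw [hT]; ring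
  have hTpos : 0 < T + b := by rw [hTb]; positivity
  have hX : ∀ p : ℝ × ℝ, partialX v p = ((l ^ c : ℝ) : ℂ) *
      (((l⁻¹ : ℝ) : ℂ) * partialX u (p.1 / l, (p.2 + b) / l ^ 2 - b)) := by
    intro p
    have h := deriv_affine_aux ((l ^ c : ℝ) : ℂ)
      (fun y => u (y, (p.2 + b) / l ^ 2 - b)) l⁻¹ 0 p.1
    simp only [add_zero, inv_mul_eq_div] at h
    simp only [partialX, hv']
    exact h
  have hXX : partialX (partialX v) (x, t) = ((l ^ c : ℝ) : ℂ) * ((l⁻¹ : ℝ) : ℂ) *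
      (((l⁻¹ : ℝ) : ℂ) * partialX (partialX u) (x / l, T)) := by
    have h := deriv_affine_aux (((l ^ c : ℝ) : ℂ) * ((l⁻¹ : ℝ) : ℂ))
      (fun y => partialX u (y, T)) l⁻¹ 0 x
    simp only [add_zero, inv_mul_eq_div] at h
    rw [show partialX v = _ from funext hX]
    unfold partialX at h ⊢
    simp only [← mul_assoc] at h ⊢
    exact h
  have hTT : partialT v (x, t) = ((l ^ c : ℝ) : ℂ) *
      ((((l ^ 2)⁻¹ : ℝ) : ℂ) * partialT u (x / l, T)) := by
    have h := deriv_affine_aux ((l ^ c : ℝ) : ℂ)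
      (fun y => u (x / l, y)) (l ^ 2)⁻¹ (b / l ^ 2 - b) t
    have e : ∀ y : ℝ, (l ^ 2)⁻¹ * y + (b / l ^ 2 - b) = (y + b) / l ^ 2 - b := by
      intro y; ring
    simp only [e] at h
    simp only [partialT, hv']
    exact h
  have hvp : v (x, t) = ((l ^ c : ℝ) : ℂ) * u (x / l, T) := hv (x, t)
  have hL : 0 < l ^ c := Real.rpow_pos_of_pos hl c
  have hn : (‖v (x, t)‖ : ℂ) = ((l ^ c : ℝ) : ℂ) * (‖u (x / l, T)‖ : ℂ) := by
    rw [hvp, norm_mul, Complex.norm_real, Real.norm_of_nonneg hL.le]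
    push_cast; rfl
  have e1 : (T + b) ^ (-(1 + c)) = (t + b) ^ (-(1 + c)) * l ^ 2 * (l ^ c) ^ 2 := by
    have h := rpow_aux l (t + b) c 1 hl hp
    rw [one_mul, show (2 * 1 : ℝ) = ((2 : ℕ) : ℝ) by norm_num, Real.rpow_natCast] at h
    rw [hTb, h]
  have e2 : (T + b) ^ (-(1 + 2 * c)) = (t + b) ^ (-(1 + 2 * c)) * l ^ 2 * (l ^ c) ^ 4 := by
    have h := rpow_aux l (t + b) c 2 hl hp
    rw [show (2 * 2 : ℝ) = ((4 : ℕ) : ℝ) by norm_num, Real.rpow_natCast] at h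
    rw [hTb, h]
  have hsq : Real.sqrt (T + b) = Real.sqrt (t + b) / l := by
    rw [hTb, Real.sqrt_div hp.le, Real.sqrt_sq hl.le]
  have hs0 : Real.sqrt (t + b) ≠ 0 := (Real.sqrt_pos.2 hp).ne'
  have e3 : ∀ k : ℝ, k * a * (x / l) / Real.sqrt (T + b) = k * a * x / Real.sqrt (t + b) := by
    intro k; rw [hsq]; field_simp
  have e4 : a * (x / l) / (2 * (T + b) ^ ((3 : ℝ) / 2))
      = a * x / (2 * (t + b) ^ ((3 : ℝ) / 2)) * l ^ 2 := by
    have h3 : (l ^ 2) ^ ((3 : ℝ) / 2) = l ^ 3 := by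
      rw [← Real.rpow_natCast l 2, ← Real.rpow_mul hl.le, ← Real.rpow_natCast l 3]
      norm_num
    have h0 : (t + b) ^ ((3 : ℝ) / 2) ≠ 0 := (Real.rpow_pos_of_pos hp _).ne'
    rw [hTb, Real.div_rpow hp.le (by positivity), h3]
    field_simp
  have key := heq (x / l, T) hTpos
  simp only [e1, e2, e3, e4] at key
  rw [hn, hXX, hTT, hvp]
  have hlc : (l : ℂ) ≠ 0 := by exact_mod_cast hl0
  have key2 := congrArg (fun z => ((l ^ c : ℝ) : ℂ) * ((l : ℂ) ^ 2)⁻¹ * z) key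
  simp only [mul_zero] at key2
  rw [← key2]
  simp only [ofReal_mul, ofReal_pow, ofReal_inv]
  field_simp
end

section
/- Let a, g₁, g₂, q₁, q₂, h₁, h₂ ∈ ℝ and s ∈ ℝ. If u : ℝ² → ℂ is twice continuously differentiable and satisfies the equation with linear potential i u_t + u_xx + (g₁ + i g₂) e^{−2 a x} |u|²u + (q₁ + i q₂) e^{−4 a x} |u|⁴u + (x + h₁ + i h₂) u = 0 on ℝ², then v(x,t) := e^{a s} e^{i s t} u(x − s, t) satisfies the same equation on ℝ². -/
open Complex

theorem partialX_shift (c : ℝ → ℂ) (s : ℝ) (w v : ℝ × ℝ → ℂ)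
    (hv : ∀ p : ℝ × ℝ, v p = c p.2 * w (p.1 - s, p.2)) (p : ℝ × ℝ) :
    partialX v p = c p.2 * partialX w (p.1 - s, p.2) := by
  unfold partialX
  simp only [hv]
  rw [deriv_const_mul_field]
  congr 1
  exact deriv_comp_sub_const (f := fun y => w (y, p.2)) s p.1

/-- The symmetry generated by Q₃ = ∂ₓ + a ρ∂_ρ + t ∂_ω of the nilpotent class A¹₃.₅. -/
theorem symmetry_A135 (a g₁ g₂ q₁ q₂ h₁ h₂ s : ℝ)
    (u : ℝ × ℝ → ℂ) (hu : ContDiff ℝ 2 u)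
    (heq : ∀ p : ℝ × ℝ,
      I * partialT u p + partialX (partialX u) p
        + ((g₁ : ℂ) + I * g₂) * ((Real.exp (-2 * a * p.1) : ℝ) : ℂ) * (‖u p‖ : ℂ) ^ 2 * u p
        + ((q₁ : ℂ) + I * q₂) * ((Real.exp (-4 * a * p.1) : ℝ) : ℂ) * (‖u p‖ : ℂ) ^ 4 * u p
        + (((p.1 + h₁ : ℝ) : ℂ) + I * h₂) * u p = 0)
    (v : ℝ × ℝ → ℂ)
    (hv : ∀ p : ℝ × ℝ,
      v p = ((Real.exp (a * s) : ℝ) : ℂ) * Complex.exp (I * ((s * p.2 : ℝ) : ℂ)) * u (p.1 - s, p.2)) :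
    ∀ p : ℝ × ℝ,
      I * partialT v p + partialX (partialX v) p
        + ((g₁ : ℂ) + I * g₂) * ((Real.exp (-2 * a * p.1) : ℝ) : ℂ) * (‖v p‖ : ℂ) ^ 2 * v p
        + ((q₁ : ℂ) + I * q₂) * ((Real.exp (-4 * a * p.1) : ℝ) : ℂ) * (‖v p‖ : ℂ) ^ 4 * v p
        + (((p.1 + h₁ : ℝ) : ℂ) + I * h₂) * v p = 0 := by
  intro p
  have hX := partialX_shift
    (fun t => ((Real.exp (a * s) : ℝ) : ℂ) * Complex.exp (I * ((s * t : ℝ) : ℂ))) s u v hv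
  have hXX := partialX_shift
    (fun t => ((Real.exp (a * s) : ℝ) : ℂ) * Complex.exp (I * ((s * t : ℝ) : ℂ))) s (partialX u)
    (partialX v) hX p
  have hT : partialT v p = ((Real.exp (a * s) : ℝ) : ℂ) * Complex.exp (I * ((s * p.2 : ℝ) : ℂ))
      * (I * s * u (p.1 - s, p.2) + partialT u (p.1 - s, p.2)) := by
    have hd : HasDerivAt (fun t : ℝ => u (p.1 - s, t)) (partialT u (p.1 - s, p.2)) p.2 := by
      apply DifferentiableAt.hasDerivAt
      have := hu.differentiable (by norm_num)
      fun_prop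
    have he : HasDerivAt (fun t : ℝ => Complex.exp (I * ((s * t : ℝ) : ℂ)))
        (Complex.exp (I * ((s * p.2 : ℝ) : ℂ)) * (I * ((s * 1 : ℝ) : ℂ))) p.2 :=
      ((((hasDerivAt_id p.2).const_mul s).ofReal_comp).const_mul I).cexp
    have h := ((he.const_mul ((Real.exp (a * s) : ℝ) : ℂ)).mul hd).deriv
    have h2 : partialT v p = deriv (fun t : ℝ => ((Real.exp (a * s) : ℝ) : ℂ) *
        Complex.exp (I * ((s * t : ℝ) : ℂ)) * u (p.1 - s, t)) p.2 := by
      simp only [partialT, hv]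
    rw [h2]
    refine h.trans ?_
    push_cast
    ring
  have hn : ‖v p‖ = Real.exp (a * s) * ‖u (p.1 - s, p.2)‖ := by
    rw [hv, norm_mul, norm_mul, mul_comm I, Complex.norm_exp_ofReal_mul_I, Complex.norm_real,
      Real.norm_eq_abs, abs_of_pos (Real.exp_pos _), mul_one]
  have e2 : Real.exp (-2 * a * (p.1 - s)) = Real.exp (-2 * a * p.1) * Real.exp (a * s) ^ 2 := by
    rw [← Real.exp_nat_mul, ← Real.exp_add]
    congr 1
    push_cast
    ring
  have e4 : Real.exp (-4 * a * (p.1 - s)) = Real.exp (-4 * a * p.1) * Real.exp (a * s) ^ 4 := by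
    rw [← Real.exp_nat_mul, ← Real.exp_add]
    congr 1
    push_cast
    ring
  have h0 := heq (p.1 - s, p.2)
  simp only [e2, e4] at h0
  rw [hT, hXX, hn, hv]
  generalize partialX (partialX u) (p.1 - s, p.2) = A at *
  generalize partialT u (p.1 - s, p.2) = B at *
  generalize Complex.exp (I * ((s * p.2 : ℝ) : ℂ)) = E at *
  generalize Real.exp (a * s) = C at *
  push_cast at h0 ⊢
  linear_combination (C : ℂ) * E * h0 + (C : ℂ) * E * s * u (p.1 - s, p.2) * Complex.I_mul_I
end

section
/- Let g₁, g₂, q₁, q₂, h₁, h₂ ∈ ℝ and c ∈ ℝ. If u : (0,∞) × ℝ → ℂ is twice continuously differentiable and satisfies i u_t + u_xx + (g₁ + i g₂) x^{−1} |u|²u + (q₁ + i q₂) |u|⁴u + (h₁ + i h₂) x^{−2} u = 0 for all x > 0, t ∈ ℝ, then the conformally transformed function v(x,t) := (1 + c t)^{−1/2} · exp( i c x²/(4(1 + c t)) ) · u( x/(1 + c t), t/(1 + c t) ) satisfies the same equation on the domain {(x,t) : x > 0, 1 + c t > 0}. -/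
open Complex

lemma aux_fderiv (u : ℝ × ℝ → ℂ) (hu : ContDiffOn ℝ 2 u {p : ℝ × ℝ | 0 < p.1})
    (p : ℝ × ℝ) (hp : 0 < p.1) : HasFDerivAt u (fderiv ℝ u p) p := by
  have hO : IsOpen {p : ℝ × ℝ | 0 < p.1} := isOpen_lt continuous_const continuous_fst
  exact ((hu.contDiffAt (hO.mem_nhds hp)).differentiableAt (by norm_num)).hasFDerivAt

lemma aux_x (u : ℝ × ℝ → ℂ) (hu : ContDiffOn ℝ 2 u {p : ℝ × ℝ | 0 < p.1})
    (p : ℝ × ℝ) (hp : 0 < p.1) :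
    HasDerivAt (fun y => u (y, p.2)) (fderiv ℝ u p (1, 0)) p.1 := by
  have h1 : HasDerivAt (fun y : ℝ => (y, p.2)) ((1 : ℝ), (0 : ℝ)) p.1 :=
    (hasDerivAt_id p.1).prodMk (hasDerivAt_const p.1 p.2)
  exact HasFDerivAt.comp_hasDerivAt (l := u) (f := fun y : ℝ => (y, p.2)) p.1
    (aux_fderiv u hu p hp) h1

lemma aux_t (u : ℝ × ℝ → ℂ) (hu : ContDiffOn ℝ 2 u {p : ℝ × ℝ | 0 < p.1})
    (p : ℝ × ℝ) (hp : 0 < p.1) :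
    HasDerivAt (fun y => u (p.1, y)) (fderiv ℝ u p (0, 1)) p.2 := by
  have h1 : HasDerivAt (fun y : ℝ => (p.1, y)) ((0 : ℝ), (1 : ℝ)) p.2 :=
    (hasDerivAt_const p.2 p.1).prodMk (hasDerivAt_id p.2)
  exact HasFDerivAt.comp_hasDerivAt (l := u) (f := fun y : ℝ => (p.1, y)) p.2
    (aux_fderiv u hu p hp) h1

lemma aux_xx (u : ℝ × ℝ → ℂ) (hu : ContDiffOn ℝ 2 u {p : ℝ × ℝ | 0 < p.1})
    (p : ℝ × ℝ) (hp : 0 < p.1) :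
    HasDerivAt (fun y => partialX u (y, p.2)) (partialX (partialX u) p) p.1 := by
  have hO : IsOpen {p : ℝ × ℝ | 0 < p.1} := isOpen_lt continuous_const continuous_fst
  have hd : DifferentiableAt ℝ (fderiv ℝ u) p :=
    ((hu.contDiffAt (hO.mem_nhds hp)).fderiv_right (m := 1) (by norm_num)).differentiableAt
      (by norm_num)
  have h1 : DifferentiableAt ℝ (fun y : ℝ => (y, p.2)) p.1 := by fun_prop
  have h2 : DifferentiableAt ℝ (fun y : ℝ => fderiv ℝ u (y, p.2)) p.1 :=
    DifferentiableAt.comp (g := fderiv ℝ u) (f := fun y : ℝ => (y, p.2)) p.1 hd h1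
  have h3 : DifferentiableAt ℝ (fun y : ℝ => fderiv ℝ u (y, p.2) (1, 0)) p.1 :=
    h2.clm_apply (differentiableAt_const _)
  have h4 : (fun y => partialX u (y, p.2)) =ᶠ[nhds p.1]
      (fun y : ℝ => fderiv ℝ u (y, p.2) (1, 0)) := by
    filter_upwards [lt_mem_nhds hp] with y hy
    exact (aux_x u hu (y, p.2) hy).deriv
  exact (h3.congr_of_eventuallyEq h4).hasDerivAt

/-- The conformal symmetry generated by Q₃ = x t ∂ₓ + t² ∂_t − (1/2) t ρ ∂_ρ + (x²/4) ∂_ω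
    of the non-solvable class A₃.₃ ⊕ A₁. -/
theorem conformal_A33A1 (g₁ g₂ q₁ q₂ h₁ h₂ c : ℝ)
    (u : ℝ × ℝ → ℂ) (hu : ContDiffOn ℝ 2 u {p : ℝ × ℝ | 0 < p.1})
    (heq : ∀ p : ℝ × ℝ, 0 < p.1 →
      I * partialT u p + partialX (partialX u) p
        + ((g₁ : ℂ) + I * g₂) * ((p.1⁻¹ : ℝ) : ℂ) * (‖u p‖ : ℂ) ^ 2 * u p
        + ((q₁ : ℂ) + I * q₂) * (‖u p‖ : ℂ) ^ 4 * u p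
        + ((h₁ : ℂ) + I * h₂) * ((p.1 ^ (-2 : ℝ) : ℝ) : ℂ) * u p = 0)
    (v : ℝ × ℝ → ℂ)
    (hv : ∀ p : ℝ × ℝ,
      v p = (((1 + c * p.2) ^ (-(1 : ℝ) / 2) : ℝ) : ℂ)
              * Complex.exp (I * ((c * p.1 ^ 2 / (4 * (1 + c * p.2)) : ℝ) : ℂ))
              * u (p.1 / (1 + c * p.2), p.2 / (1 + c * p.2))) :
    ∀ p : ℝ × ℝ, 0 < p.1 → 0 < 1 + c * p.2 →
      I * partialT v p + partialX (partialX v) p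
        + ((g₁ : ℂ) + I * g₂) * ((p.1⁻¹ : ℝ) : ℂ) * (‖v p‖ : ℂ) ^ 2 * v p
        + ((q₁ : ℂ) + I * q₂) * (‖v p‖ : ℂ) ^ 4 * v p
        + ((h₁ : ℂ) + I * h₂) * ((p.1 ^ (-2 : ℝ) : ℝ) : ℂ) * v p = 0 := by
  rintro ⟨x, t⟩ hx hs
  simp only at hx hs
  set s : ℝ := 1 + c * t with hsdef
  have hsne : s ≠ 0 := hs.ne'
  have hsC : (s : ℂ) ≠ 0 := by exact_mod_cast hsne
  have hX : 0 < x / s := div_pos hx hs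
  set E : ℝ → ℝ → ℂ := fun y r => Complex.exp (I * ((c * y ^ 2 / (4 * (1 + c * r)) : ℝ) : ℂ))
    with hE
  set A : ℂ := ((s ^ (-(1 : ℝ) / 2) : ℝ) : ℂ) with hA
  -- space derivative
  have hEx : ∀ y : ℝ, HasDerivAt (fun y => E y t) (E y t * (I * (c * y / (2 * s)))) y := by
    intro y
    have h1 : HasDerivAt (fun y : ℝ => c * y ^ 2 / (4 * s)) (c * y / (2 * s)) y := by
      refine HasDerivAt.congr_deriv ((((hasDerivAt_id y).pow 2).const_mul c).div_const (4 * s)) ?_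
      simp only [id]; field_simp; norm_num; try ring
    refine HasDerivAt.congr_deriv ((h1.ofReal_comp.const_mul I).cexp) ?_
    simp only [hE, ← hsdef]; push_cast; ring
  have hvx : ∀ y : ℝ, 0 < y → HasDerivAt (fun y => v (y, t))
      (A * (E y t * (I * (c * y / (2 * s)))) * u (y / s, t / s)
        + A * E y t * (partialX u (y / s, t / s) * (s : ℂ)⁻¹)) y := by
    intro y hy
    have h0 : (fun y => v (y, t)) = fun y => A * E y t * u (y / s, t / s) := by
      funext y; rw [hv]
    rw [h0]
    have h1 := aux_x u hu (y / s, t / s) (div_pos hy hs)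
    have h2 : HasDerivAt (fun y => u (y, t / s)) (partialX u (y / s, t / s)) (y / s) :=
      h1.differentiableAt.hasDerivAt
    have h3 : HasDerivAt (fun y : ℝ => y / s) (s⁻¹) y := by
      simpa using (hasDerivAt_id y).div_const s
    have h4 : HasDerivAt (fun y => u (y / s, t / s))
        (s⁻¹ • partialX u (y / s, t / s)) y :=
      HasDerivAt.scomp (g₁ := fun y => u (y, t / s)) (h := fun y : ℝ => y / s) y h2 h3
    refine HasDerivAt.congr_deriv (((hEx y).const_mul A).mul h4) ?_
    rw [Complex.real_smul]; push_cast; ring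
  have hvxx : partialX (partialX v) (x, t) =
      A * E x t * ((I * (c * x / (2 * s))) ^ 2 * u (x / s, t / s) + I * (c / (2 * s)) * u (x / s, t / s)
        + 2 * (I * (c * x / (2 * s))) * (partialX u (x / s, t / s) * (s : ℂ)⁻¹)
        + partialX (partialX u) (x / s, t / s) * (s : ℂ)⁻¹ ^ 2) := by
    have h0 : (fun y => partialX v (y, t)) =ᶠ[nhds x] fun y =>
        A * (E y t * (I * (c * y / (2 * s)))) * u (y / s, t / s)
        + A * E y t * (partialX u (y / s, t / s) * (s : ℂ)⁻¹) := by
      filter_upwards [lt_mem_nhds hx] with y hy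
      exact (hvx y hy).deriv
    have h2 : HasDerivAt (fun y => u (y, t / s)) (partialX u (x / s, t / s)) (x / s) :=
      (aux_x u hu (x / s, t / s) hX).differentiableAt.hasDerivAt
    have h2' := aux_xx u hu (x / s, t / s) hX
    have h3 : HasDerivAt (fun y : ℝ => y / s) (s⁻¹) x := by
      simpa using (hasDerivAt_id x).div_const s
    have h4 : HasDerivAt (fun y => u (y / s, t / s))
        (s⁻¹ • partialX u (x / s, t / s)) x :=
      HasDerivAt.scomp (g₁ := fun y => u (y, t / s)) (h := fun y : ℝ => y / s) x h2 h3
    have h5 : HasDerivAt (fun y => partialX u (y / s, t / s))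
        (s⁻¹ • partialX (partialX u) (x / s, t / s)) x :=
      HasDerivAt.scomp (g₁ := fun y => partialX u (y, t / s)) (h := fun y : ℝ => y / s) x h2' h3
    have h6 : HasDerivAt (fun y : ℝ => I * ((c : ℂ) * (y : ℂ) / (2 * s))) (I * (c / (2 * s))) x := by
      have h := ((((hasDerivAt_id x).ofReal_comp).const_mul (c : ℂ)).div_const (2 * (s : ℂ))).const_mul I
      simpa using h
    have h7 := ((((hEx x).mul h6).const_mul A).mul h4).add
      (((hEx x).const_mul A).mul (h5.mul_const ((s : ℂ)⁻¹)))
    have h8 := (h7.congr_of_eventuallyEq h0).deriv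
    refine Eq.trans h8 ?_
    simp only [Complex.real_smul, Pi.mul_apply]; push_cast; ring
  have hvt : partialT v (x, t) =
      A * E x t * (-(c / (2 * s)) * u (x / s, t / s)
        - I * (c ^ 2 * x ^ 2 / (4 * s ^ 2)) * u (x / s, t / s)
        - c * x / s ^ 2 * partialX u (x / s, t / s)
        + partialT u (x / s, t / s) / s ^ 2) := by
    have hσ : HasDerivAt (fun r : ℝ => 1 + c * r) c t := by
      simpa using ((hasDerivAt_id t).const_mul c).const_add 1
    have hAt : HasDerivAt (fun r : ℝ => (((1 + c * r) ^ (-(1 : ℝ) / 2) : ℝ) : ℂ))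
        (A * (-(c / (2 * s)))) t := by
      have h := (hσ.rpow_const (p := -(1 : ℝ) / 2) (Or.inl hsne)).ofReal_comp
      convert h using 1
      rw [← hsdef, Real.rpow_sub_one hsne, hA]
      push_cast; field_simp
    have hEt : HasDerivAt (fun r => E x r) (E x t * (- I * (c ^ 2 * x ^ 2 / (4 * s ^ 2)))) t := by
      have h1 : HasDerivAt (fun r : ℝ => c * x ^ 2 / (4 * (1 + c * r)))
          (-(c ^ 2 * x ^ 2 / (4 * s ^ 2))) t := by
        refine HasDerivAt.congr_deriv ((hasDerivAt_const t (c * x ^ 2)).div (hσ.const_mul 4) (by positivity)) ?_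
        simp only [← hsdef]; field_simp; ring
      refine HasDerivAt.congr_deriv ((h1.ofReal_comp.const_mul I).cexp) ?_
      push_cast
      simp only [hE]; push_cast; ring
    have hc1 : HasDerivAt (fun r : ℝ => x / (1 + c * r)) (-(c * x / s ^ 2)) t := by
      refine HasDerivAt.congr_deriv ((hasDerivAt_const t x).div hσ hsne) ?_
      simp only [← hsdef]; ring
    have hc2 : HasDerivAt (fun r : ℝ => r / (1 + c * r)) (1 / s ^ 2) t := by
      refine HasDerivAt.congr_deriv ((hasDerivAt_id t).div hσ hsne) ?_
      simp only [id, ← hsdef]; congr 1; rw [hsdef]; ring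
    have hU := HasFDerivAt.comp_hasDerivAt (l := u)
      (f := fun r : ℝ => (x / (1 + c * r), r / (1 + c * r))) t
      (aux_fderiv u hu (x / s, t / s) hX) (hc1.prodMk hc2)
    have e1 : partialX u (x / s, t / s) = fderiv ℝ u (x / s, t / s) (1, 0) :=
      (aux_x u hu (x / s, t / s) hX).deriv
    have e2 : partialT u (x / s, t / s) = fderiv ℝ u (x / s, t / s) (0, 1) :=
      (aux_t u hu (x / s, t / s) hX).deriv
    have e3 : fderiv ℝ u (x / s, t / s) (-(c * x / s ^ 2), 1 / s ^ 2) =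
        (-(c * x / s ^ 2)) • partialX u (x / s, t / s)
          + (1 / s ^ 2) • partialT u (x / s, t / s) := by
      rw [e1, e2, ← map_smul, ← map_smul, ← map_add]
      simp
    rw [e3] at hU
    have h0 : (fun r => v (x, r)) = fun r => (((1 + c * r) ^ (-(1 : ℝ) / 2) : ℝ) : ℂ) * E x r *
        u (x / (1 + c * r), r / (1 + c * r)) := by
      funext r; rw [hv]
    have h1 := ((hAt.mul hEt).mul hU).deriv
    have h2 : partialT v (x, t) = deriv (fun r => (((1 + c * r) ^ (-(1 : ℝ) / 2) : ℝ) : ℂ) * E x r *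
        u (x / (1 + c * r), r / (1 + c * r))) t := by
      rw [← h0]; rfl
    rw [h2]
    refine Eq.trans h1 ?_
    simp only [Complex.real_smul, Function.comp, Pi.mul_apply, ← hsdef, ← hA]
    push_cast; ring
  have hvv : v (x, t) = A * E x t * u (x / s, t / s) := by rw [hv]
  have hEn : ‖E x t‖ = 1 := by
    simp only [hE]; rw [mul_comm, Complex.norm_exp_ofReal_mul_I]
  have hA2 : (‖A‖) ^ 2 = s⁻¹ := by
    rw [hA, Complex.norm_real, Real.norm_eq_abs, sq_abs, ← Real.rpow_natCast, ← Real.rpow_mul hs.le,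
      ← Real.rpow_neg_one]
    norm_num
  have hn2 : ((‖v (x, t)‖ : ℂ)) ^ 2 = (s : ℂ)⁻¹ * (‖u (x / s, t / s)‖ : ℂ) ^ 2 := by
    rw [hvv, norm_mul, norm_mul, hEn, mul_one]
    have : ((‖A‖ : ℂ)) ^ 2 = (s : ℂ)⁻¹ := by exact_mod_cast hA2
    push_cast; rw [mul_pow, this]
  have hn4 : ((‖v (x, t)‖ : ℂ)) ^ 4 = (s : ℂ)⁻¹ ^ 2 * (‖u (x / s, t / s)‖ : ℂ) ^ 4 := by
    have : ((‖v (x, t)‖ : ℂ)) ^ 4 = (((‖v (x, t)‖ : ℂ)) ^ 2) ^ 2 := by ring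
    rw [this, hn2]; ring
  have hp2 : ∀ y : ℝ, 0 < y → y ^ (-2 : ℝ) = (y ^ 2)⁻¹ := by
    intro y hy
    rw [Real.rpow_neg hy.le]; norm_num
  have key := heq (x / s, t / s) hX
  simp only at key ⊢
  rw [hp2 _ hX] at key
  rw [hvt, hvxx, hn2, hn4, hvv, hp2 _ hx]
  have hxC : (x : ℂ) ≠ 0 := by exact_mod_cast hx.ne'
  generalize partialX (partialX u) (x / s, t / s) = uxx at *
  generalize partialX u (x / s, t / s) = ux at *
  generalize partialT u (x / s, t / s) = ut at *
  generalize (‖u (x / s, t / s)‖ : ℂ) = N at *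
  generalize u (x / s, t / s) = U at *
  push_cast at key ⊢
  have hI : I ^ 2 = -1 := Complex.I_sq
  have hm := congrArg (fun z => A * E x t * (s : ℂ)⁻¹ ^ 2 * z) key
  simp only [mul_zero] at hm
  rw [← hm]
  generalize E x t = e at *
  clear_value A s
  field_simp
  ring_nf
end

section
/- Let b, g₁, g₂, q₁, q₂ ∈ ℝ and c ∈ ℝ. Consider the equation i u_t + u_xx + (g₁ + i g₂)(1 + t²)^{−1/2} e^{b·arctan t} |u|²u + (q₁ + i q₂) e^{2b·arctan t} |u|⁴u = 0 for u : ℝ² → ℂ. If u is twice continuously differentiable and satisfies this equation on ℝ², then the function v(x,t) := (1 + c²)^{1/4} · e^{−(b/2)·arctan c} · (1 + c t)^{−1/2} · exp( i c x²/(4(1 + c t)) ) · u( x√(1 + c²)/(1 + c t), (t − c)/(1 + c t) ) satisfies the same equation on the domain {(x,t) : 1 + c t > 0}. -/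
open Complex

theorem chain_aux (w : ℝ × ℝ → ℂ) (hw : Differentiable ℝ w) (a d : ℝ → ℝ) (a' d' s : ℝ)
    (ha : HasDerivAt a a' s) (hd : HasDerivAt d d' s) :
    HasDerivAt (fun r => w (a r, d r))
      ((a' : ℂ) * partialX w (a s, d s) + (d' : ℂ) * partialT w (a s, d s)) s := by
  have hF : HasFDerivAt w (fderiv ℝ w (a s, d s)) (a s, d s) := (hw _).hasFDerivAt
  have hX : partialX w (a s, d s) = fderiv ℝ w (a s, d s) (1, 0) := by
    have h := HasFDerivAt.comp_hasDerivAt (f := fun y : ℝ => (y, d s)) (a s) hF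
      ((hasDerivAt_id (a s)).prodMk (hasDerivAt_const (a s) (d s)))
    exact h.deriv
  have hT : partialT w (a s, d s) = fderiv ℝ w (a s, d s) (0, 1) := by
    have h := HasFDerivAt.comp_hasDerivAt (f := fun y : ℝ => (a s, y)) (d s) hF
      ((hasDerivAt_const (d s) (a s)).prodMk (hasDerivAt_id (d s)))
    exact h.deriv
  have h := HasFDerivAt.comp_hasDerivAt (f := fun r : ℝ => (a r, d r)) s hF (ha.prodMk hd)
  have e : ((a', d') : ℝ × ℝ) = a' • ((1 : ℝ), (0 : ℝ)) + d' • ((0 : ℝ), (1 : ℝ)) := by simp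
  rw [e, map_add, map_smul, map_smul, ← hX, ← hT] at h
  simp only [real_smul] at h
  exact h

theorem partialX_diff (w : ℝ × ℝ → ℂ) (hw : ContDiff ℝ 2 w) : Differentiable ℝ (partialX w) := by
  have hd : Differentiable ℝ w := hw.differentiable (by norm_num)
  have e : partialX w = fun p => fderiv ℝ w p (1, 0) := by
    funext p
    have h := HasFDerivAt.comp_hasDerivAt (f := fun y : ℝ => (y, p.2)) p.1 (hd (p.1, p.2)).hasFDerivAt
      ((hasDerivAt_id p.1).prodMk (hasDerivAt_const p.1 p.2))
    exact h.deriv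
  rw [e]
  have h1 : ContDiff ℝ 1 (fderiv ℝ w) := hw.fderiv_right (by norm_num)
  exact (h1.differentiable (by norm_num)).clm_apply (differentiable_const _)

theorem phase_x (c D y : ℝ) :
    HasDerivAt (fun y : ℝ => Complex.exp (I * ((c * y ^ 2 / (4 * D) : ℝ) : ℂ)))
      (Complex.exp (I * ((c * y ^ 2 / (4 * D) : ℝ) : ℂ)) * (I * ((c * y / (2 * D) : ℝ) : ℂ))) y := by
  have h : HasDerivAt (fun y : ℝ => c * y ^ 2 / (4 * D)) (c * y / (2 * D)) y := by
    have := (((hasDerivAt_id y).pow 2).const_mul c).div_const (4 * D)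
    refine HasDerivAt.congr_deriv this ?_
    simp only [id]
    by_cases hD : D = 0
    · simp [hD]
    · field_simp
      norm_num
      try ring
  exact (h.ofReal_comp.const_mul I).cexp

theorem scal_t (c x t : ℝ) (hD : 0 < 1 + c * t) :
    HasDerivAt (fun s : ℝ => (((1 + c * s) ^ (-(1 : ℝ) / 2) : ℝ) : ℂ)
        * Complex.exp (I * ((c * x ^ 2 / (4 * (1 + c * s)) : ℝ) : ℂ)))
      ((((1 + c * t) ^ (-(1 : ℝ) / 2) : ℝ) : ℂ)
        * Complex.exp (I * ((c * x ^ 2 / (4 * (1 + c * t)) : ℝ) : ℂ))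
        * (((-c / (2 * (1 + c * t)) : ℝ) : ℂ)
          - I * ((c ^ 2 * x ^ 2 / (4 * (1 + c * t) ^ 2) : ℝ) : ℂ))) t := by
  have h0 : HasDerivAt (fun s : ℝ => 1 + c * s) c t := by
    simpa using ((hasDerivAt_id t).const_mul c).const_add 1
  have h1 : HasDerivAt (fun s : ℝ => (1 + c * s) ^ (-(1 : ℝ) / 2))
      ((1 + c * t) ^ (-(1 : ℝ) / 2) * (-c / (2 * (1 + c * t)))) t := by
    refine HasDerivAt.congr_deriv (h0.rpow_const (p := -(1 : ℝ) / 2) (Or.inl hD.ne')) ?_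
    rw [Real.rpow_sub_one hD.ne']
    field_simp
  have h2 : HasDerivAt (fun s : ℝ => c * x ^ 2 / (4 * (1 + c * s)))
      (-(c ^ 2 * x ^ 2 / (4 * (1 + c * t) ^ 2))) t := by
    refine HasDerivAt.congr_deriv ((hasDerivAt_const t (c * x ^ 2)).fun_div (h0.const_mul 4) (by positivity)) ?_
    have := hD.ne'
    field_simp
    ring
  refine HasDerivAt.congr_deriv (h1.ofReal_comp.fun_mul (h2.ofReal_comp.const_mul I).cexp) ?_
  push_cast
  ring

theorem coef_aux (b c t : ℝ) (hD : 0 < 1 + c * t) :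
    let A := (1 + c ^ 2) ^ ((1 : ℝ) / 4) * Real.exp (-(b / 2) * Real.arctan c)
      * (1 + c * t) ^ (-(1 : ℝ) / 2)
    let T := (t - c) / (1 + c * t)
    ((1 + t ^ 2) ^ (-(1 : ℝ) / 2) * Real.exp (b * Real.arctan t) * A ^ 2 =
      (1 + c ^ 2) / (1 + c * t) ^ 2 *
        ((1 + T ^ 2) ^ (-(1 : ℝ) / 2) * Real.exp (b * Real.arctan T))) ∧
    (Real.exp (2 * b * Real.arctan t) * A ^ 4 =
      (1 + c ^ 2) / (1 + c * t) ^ 2 * Real.exp (2 * b * Real.arctan T)) := by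
  intro A T
  have hk : (0 : ℝ) < 1 + c ^ 2 := by positivity
  have ht : (0 : ℝ) < 1 + t ^ 2 := by positivity
  have hT : Real.arctan T = Real.arctan t - Real.arctan c := by
    have := Real.arctan_add (x := t) (y := -c) (by nlinarith)
    rw [Real.arctan_neg] at this
    rw [sub_eq_add_neg, this]
    congr 1
    simp only [T]
    congr 1
    ring
  have r1 : ((1 + c ^ 2) ^ ((1 : ℝ) / 4)) ^ 2 = Real.sqrt (1 + c ^ 2) := by
    rw [← Real.rpow_natCast, ← Real.rpow_mul hk.le, Real.sqrt_eq_rpow]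
    norm_num
  have r2 : ((1 + c * t) ^ (-(1 : ℝ) / 2)) ^ 2 = (1 + c * t)⁻¹ := by
    rw [← Real.rpow_natCast, ← Real.rpow_mul hD.le, ← Real.rpow_neg_one]
    norm_num
  have r3 : (Real.exp (-(b / 2) * Real.arctan c)) ^ 2 = Real.exp (-(b * Real.arctan c)) := by
    rw [← Real.exp_nat_mul]
    congr 1
    push_cast
    ring
  have hA : A ^ 2 = Real.sqrt (1 + c ^ 2) * Real.exp (-(b * Real.arctan c)) * (1 + c * t)⁻¹ := by
    simp only [A]
    rw [mul_pow, mul_pow, r1, r2, r3]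
  have hneg : ∀ z : ℝ, 0 < z → z ^ (-(1 : ℝ) / 2) = (Real.sqrt z)⁻¹ := by
    intro z hz
    rw [Real.sqrt_eq_rpow, ← Real.rpow_neg hz.le]
    norm_num
  have hs : Real.sqrt (1 + c ^ 2) ^ 2 = 1 + c ^ 2 := Real.sq_sqrt hk.le
  have hs0 : 0 < Real.sqrt (1 + c ^ 2) := Real.sqrt_pos.2 hk
  constructor
  · have h1T : 1 + T ^ 2 = (1 + c ^ 2) * (1 + t ^ 2) / (1 + c * t) ^ 2 := by
      have := hD.ne'
      simp only [T]
      rw [div_pow, eq_div_iff (by positivity), add_mul, div_mul_cancel₀ _ (by positivity)]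
      ring
    have e1 : Real.exp (b * Real.arctan T)
        = Real.exp (b * Real.arctan t) * Real.exp (-(b * Real.arctan c)) := by
      rw [hT, ← Real.exp_add]
      congr 1
      ring
    rw [hA, hneg _ ht, hneg _ (by positivity), h1T, e1, Real.sqrt_div' _ (by positivity),
      Real.sqrt_sq hD.le, Real.sqrt_mul hk.le]
    have : 0 < Real.sqrt (1 + t ^ 2) := Real.sqrt_pos.2 ht
    rw [← hs]
    rw [Real.sqrt_sq hs0.le]
    field_simp
  · have e1 : Real.exp (2 * b * Real.arctan T)
        = Real.exp (2 * b * Real.arctan t) * Real.exp (-(b * Real.arctan c)) ^ 2 := by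
      rw [hT, ← Real.exp_nat_mul, ← Real.exp_add]
      congr 1
      push_cast
      ring
    have : A ^ 4 = (A ^ 2) ^ 2 := by ring
    rw [this, hA, e1, mul_pow, mul_pow, hs]
    field_simp

/-- The finite form (group parameter s = arctan c) of the one-parameter symmetry group
    generated by Q₄ = x t ∂ₓ + (1+t²)∂_t − (1/2)(b+t)ρ∂_ρ + (x²/4)∂_ω of the class A₄.₉. -/
theorem symmetry_A49 (b g₁ g₂ q₁ q₂ c : ℝ)
    (u : ℝ × ℝ → ℂ) (hu : ContDiff ℝ 2 u)
    (heq : ∀ p : ℝ × ℝ,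
      I * partialT u p + partialX (partialX u) p
        + ((g₁ : ℂ) + I * g₂) * (((1 + p.2 ^ 2) ^ (-(1 : ℝ) / 2) : ℝ) : ℂ)
            * ((Real.exp (b * Real.arctan p.2) : ℝ) : ℂ) * (‖u p‖ : ℂ) ^ 2 * u p
        + ((q₁ : ℂ) + I * q₂) * ((Real.exp (2 * b * Real.arctan p.2) : ℝ) : ℂ)
            * (‖u p‖ : ℂ) ^ 4 * u p = 0)
    (v : ℝ × ℝ → ℂ)
    (hv : ∀ p : ℝ × ℝ,
      v p = (((1 + c ^ 2) ^ ((1 : ℝ) / 4) : ℝ) : ℂ)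
              * ((Real.exp (-(b / 2) * Real.arctan c) : ℝ) : ℂ)
              * (((1 + c * p.2) ^ (-(1 : ℝ) / 2) : ℝ) : ℂ)
              * Complex.exp (I * ((c * p.1 ^ 2 / (4 * (1 + c * p.2)) : ℝ) : ℂ))
              * u (p.1 * Real.sqrt (1 + c ^ 2) / (1 + c * p.2), (p.2 - c) / (1 + c * p.2))) :
    ∀ p : ℝ × ℝ, 0 < 1 + c * p.2 →
      I * partialT v p + partialX (partialX v) p
        + ((g₁ : ℂ) + I * g₂) * (((1 + p.2 ^ 2) ^ (-(1 : ℝ) / 2) : ℝ) : ℂ)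
            * ((Real.exp (b * Real.arctan p.2) : ℝ) : ℂ) * (‖v p‖ : ℂ) ^ 2 * v p
        + ((q₁ : ℂ) + I * q₂) * ((Real.exp (2 * b * Real.arctan p.2) : ℝ) : ℂ)
            * (‖v p‖ : ℂ) ^ 4 * v p = 0 := by
  rintro ⟨x, t⟩ hD
  simp only at hD ⊢
  have hud : Differentiable ℝ u := hu.differentiable (by norm_num)
  have huXd := partialX_diff u hu
  have hk : (0 : ℝ) < 1 + c ^ 2 := by positivity
  obtain ⟨hc1, hc2⟩ := coef_aux b c t hD
  have hks : Real.sqrt (1 + c ^ 2) ^ 2 = 1 + c ^ 2 := Real.sq_sqrt hk.le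
  set k := Real.sqrt (1 + c ^ 2) with hkdef
  set T := (t - c) / (1 + c * t) with hTdef
  set A := (1 + c ^ 2) ^ ((1 : ℝ) / 4) * Real.exp (-(b / 2) * Real.arctan c)
      * (1 + c * t) ^ (-(1 : ℝ) / 2) with hAdef
  have hA0 : 0 ≤ A := by positivity
  have hin : ∀ y : ℝ, HasDerivAt (fun y : ℝ => y * k / (1 + c * t)) (k / (1 + c * t)) y := by
    intro y
    simpa using ((hasDerivAt_id y).mul_const k).div_const (1 + c * t)
  have hvy : ∀ y : ℝ, v (y, t) = (A : ℂ)
      * (Complex.exp (I * ((c * y ^ 2 / (4 * (1 + c * t)) : ℝ) : ℂ))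
      * u (y * k / (1 + c * t), T)) := by
    intro y
    rw [hv]
    simp only [hAdef, ofReal_mul]
    ring
  have hvX : ∀ y : ℝ, partialX v (y, t) = (A : ℂ)
      * (Complex.exp (I * ((c * y ^ 2 / (4 * (1 + c * t)) : ℝ) : ℂ))
      * (I * ((c * y / (2 * (1 + c * t)) : ℝ) : ℂ) * u (y * k / (1 + c * t), T)
        + ((k / (1 + c * t) : ℝ) : ℂ) * partialX u (y * k / (1 + c * t), T))) := by
    intro y
    have h := ((phase_x c (1 + c * t) y).mul (chain_aux u hud _ _ _ _ y (hin y)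
      (hasDerivAt_const y T))).const_mul (A : ℂ)
    simp only [partialX]
    simp only [hvy]
    refine h.deriv.trans ?_
    simp only [partialX]
    push_cast
    ring
  have hvXX : partialX (partialX v) (x, t) = (A : ℂ)
      * (Complex.exp (I * ((c * x ^ 2 / (4 * (1 + c * t)) : ℝ) : ℂ))
      * (I * ((c * x / (2 * (1 + c * t)) : ℝ) : ℂ) *
          (I * ((c * x / (2 * (1 + c * t)) : ℝ) : ℂ) * u (x * k / (1 + c * t), T)
        + ((k / (1 + c * t) : ℝ) : ℂ) * partialX u (x * k / (1 + c * t), T))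
        + (I * ((c / (2 * (1 + c * t)) : ℝ) : ℂ) * u (x * k / (1 + c * t), T)
        + I * ((c * x / (2 * (1 + c * t)) : ℝ) : ℂ) *
          (((k / (1 + c * t) : ℝ) : ℂ) * partialX u (x * k / (1 + c * t), T))
        + ((k / (1 + c * t) : ℝ) : ℂ) * (((k / (1 + c * t) : ℝ) : ℂ)
          * partialX (partialX u) (x * k / (1 + c * t), T))))) := by
    have hl : HasDerivAt (fun y : ℝ => c * y / (2 * (1 + c * t))) (c / (2 * (1 + c * t))) x := by
      simpa using ((hasDerivAt_id x).const_mul c).div_const (2 * (1 + c * t))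
    have h := ((phase_x c (1 + c * t) x).mul
      (((hl.ofReal_comp.const_mul I).mul (chain_aux u hud _ _ _ _ x (hin x)
      (hasDerivAt_const x T))).add ((chain_aux (partialX u) huXd _ _ _ _ x (hin x)
      (hasDerivAt_const x T)).const_mul ((k / (1 + c * t) : ℝ) : ℂ)))).const_mul (A : ℂ)
    have e : partialX (partialX v) (x, t) = deriv (fun y => partialX v (y, t)) x := rfl
    rw [e]
    simp only [hvX]
    refine h.deriv.trans ?_
    simp only [Pi.mul_apply, Pi.add_apply, ofReal_zero, zero_mul, add_zero]
    ring
  have hvT : partialT v (x, t) = (A : ℂ)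
      * (Complex.exp (I * ((c * x ^ 2 / (4 * (1 + c * t)) : ℝ) : ℂ))
      * ((((-c / (2 * (1 + c * t)) : ℝ) : ℂ)
          - I * ((c ^ 2 * x ^ 2 / (4 * (1 + c * t) ^ 2) : ℝ) : ℂ)) * u (x * k / (1 + c * t), T)
        + (((-(c * x * k) / (1 + c * t) ^ 2 : ℝ) : ℂ) * partialX u (x * k / (1 + c * t), T)
        + (((1 + c ^ 2) / (1 + c * t) ^ 2 : ℝ) : ℂ) * partialT u (x * k / (1 + c * t), T)))) := by
    have h0 : HasDerivAt (fun s : ℝ => 1 + c * s) c t := by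
      simpa using ((hasDerivAt_id t).const_mul c).const_add 1
    have ha : HasDerivAt (fun s : ℝ => x * k / (1 + c * s)) (-(c * x * k) / (1 + c * t) ^ 2) t := by
      refine HasDerivAt.congr_deriv ((hasDerivAt_const t (x * k)).fun_div h0 hD.ne') ?_
      ring
    have hd : HasDerivAt (fun s : ℝ => (s - c) / (1 + c * s)) ((1 + c ^ 2) / (1 + c * t) ^ 2) t := by
      refine HasDerivAt.congr_deriv (((hasDerivAt_id t).sub_const c).fun_div h0 hD.ne') ?_
      simp only [id]
      ring
    have h := ((scal_t c x t hD).mul (chain_aux u hud _ _ _ _ t ha hd)).const_mul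
      ((((1 + c ^ 2) ^ ((1 : ℝ) / 4) : ℝ) : ℂ)
              * ((Real.exp (-(b / 2) * Real.arctan c) : ℝ) : ℂ))
    have e : partialT v (x, t) = deriv (fun s => v (x, s)) t := rfl
    have e2 : (fun s => v (x, s)) = fun s => ((((1 + c ^ 2) ^ ((1 : ℝ) / 4) : ℝ) : ℂ)
              * ((Real.exp (-(b / 2) * Real.arctan c) : ℝ) : ℂ)) *
        ((((1 + c * s) ^ (-(1 : ℝ) / 2) : ℝ) : ℂ)
        * Complex.exp (I * ((c * x ^ 2 / (4 * (1 + c * s)) : ℝ) : ℂ))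
        * u (x * k / (1 + c * s), (s - c) / (1 + c * s))) := by
      funext s
      rw [hv]
      ring
    rw [e, e2]
    refine h.deriv.trans ?_
    rw [← hTdef]
    simp only [hAdef, ofReal_mul]
    ring
  have hnorm : ‖v (x, t)‖ = A * ‖u (x * k / (1 + c * t), T)‖ := by
    rw [hvy, norm_mul, norm_mul, mul_comm I, Complex.norm_exp_ofReal_mul_I, one_mul,
      Complex.norm_real, Real.norm_of_nonneg hA0]
  have hE := heq (x * k / (1 + c * t), T)
  rw [hvT, hvXX, hnorm, hvy]
  simp only at hE
  generalize Complex.exp (I * ((c * x ^ 2 / (4 * (1 + c * t)) : ℝ) : ℂ)) = P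
  generalize partialX (partialX u) (x * k / (1 + c * t), T) = uXX at *
  generalize partialX u (x * k / (1 + c * t), T) = uX at *
  generalize partialT u (x * k / (1 + c * t), T) = uT at *
  generalize u (x * k / (1 + c * t), T) = w at *
  have hc1' := congrArg (fun r : ℝ => (r : ℂ)) hc1
  have hc2' := congrArg (fun r : ℝ => (r : ℂ)) hc2
  have hks' := congrArg (fun r : ℝ => (r : ℂ)) hks
  have hD' : (1 + (c : ℂ) * t) ≠ 0 := by exact_mod_cast hD.ne'
  simp only [ofReal_mul, ofReal_pow, ofReal_div] at hc1' hc2' hks'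
  generalize (((1 + t ^ 2) ^ (-(1 : ℝ) / 2) : ℝ) : ℂ) = G at *
  generalize (((1 + T ^ 2) ^ (-(1 : ℝ) / 2) : ℝ) : ℂ) = G' at *
  generalize ((Real.exp (b * Real.arctan t) : ℝ) : ℂ) = E at *
  generalize ((Real.exp (b * Real.arctan T) : ℝ) : ℂ) = E' at *
  generalize ((Real.exp (2 * b * Real.arctan t) : ℝ) : ℂ) = F at *
  generalize ((Real.exp (2 * b * Real.arctan T) : ℝ) : ℂ) = F' at *
  clear_value A k T
  have key : I * ((((-c / (2 * (1 + c * t)) : ℝ) : ℂ)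
          - I * ((c ^ 2 * x ^ 2 / (4 * (1 + c * t) ^ 2) : ℝ) : ℂ)) * w
        + (((-(c * x * k) / (1 + c * t) ^ 2 : ℝ) : ℂ) * uX
        + (((1 + c ^ 2) / (1 + c * t) ^ 2 : ℝ) : ℂ) * uT))
      + (I * ((c * x / (2 * (1 + c * t)) : ℝ) : ℂ) *
          (I * ((c * x / (2 * (1 + c * t)) : ℝ) : ℂ) * w
        + ((k / (1 + c * t) : ℝ) : ℂ) * uX)
        + (I * ((c / (2 * (1 + c * t)) : ℝ) : ℂ) * w
        + I * ((c * x / (2 * (1 + c * t)) : ℝ) : ℂ) *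
          (((k / (1 + c * t) : ℝ) : ℂ) * uX)
        + ((k / (1 + c * t) : ℝ) : ℂ) * (((k / (1 + c * t) : ℝ) : ℂ) * uXX)))
      = ((1 + c ^ 2 : ℝ) : ℂ) / ((1 + c * t : ℝ) : ℂ) ^ 2 * (I * uT + uXX) := by
    rw [← hks']
    have h2 : ((1 + c ^ 2 : ℝ) : ℂ) = (k : ℂ) ^ 2 := hks'.symm
    rw [ofReal_div (1 + c ^ 2), h2]
    push_cast
    field_simp
    ring_nf
    try simp only [I_sq]
    try ring
  push_cast at key hc1' hc2' ⊢
  linear_combination (A * P) * key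
    + (A * P) * ((1 + (c : ℂ) ^ 2) / (1 + (c : ℂ) * t) ^ 2) * hE
    + (A * P) * ((g₁ : ℂ) + I * g₂) * (‖w‖ : ℂ) ^ 2 * w * hc1'
    + (A * P) * ((q₁ : ℂ) + I * q₂) * (‖w‖ : ℂ) ^ 4 * w * hc2'
end

section
/- Let n ≥ 1 be a real number, ε ∈ {−1, +1}, and let a₁ ≠ 0, a₂, b₁, b₂ be real constants. Let γ : ℝ → (0,∞) and G : ℝ → ℝ be twice continuously differentiable with a₁·G(t) > 0 for all t, and let ξ, η : ℝ → ℝ be twice continuously differentiable. On the domain x > 0 define the coefficients: g(x,t) = G(t) x^{n−1} (1 + i a₂/a₁); q(x,t) = ((b₁ + i b₂)/a₁²) · G(t)² x^{2(n−1)} / γ(t); h(x,t) = h₁(x,t) + i h₂(t) with h₁ = ( (3/16)(γ'/γ)² − γ''/(8γ) ) x² + (1/(2ε)) ( (ξ'γ' − ξ''γ)/γ^{3/2} ) x + (n−1)(n−3)/(4x²) + (ξ')²/(4γ) + η' and h₂ = (1/4)( 2G'/G − γ'/γ ). Define T(t) = ∫₀ᵗ γ(τ)dτ, X(x,t) = ε√(γ(t))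 x + ξ(t), θ(x,t) = −(γ'(t)/(8γ(t))) x² − (ξ'(t)/(2ε√(γ(t)))) x + η(t), and R(x,t) = ( a₁ γ(t) / ( G(t) x^{n−1} ) )^{1/2}. If ũ : ℝ² → ℂ is twice continuously differentiable and solves the constant coefficient equation i ũ_t + ũ_xx + (a₁ + i a₂)|ũ|²ũ + (b₁ + i b₂)|ũ|⁴ũ = 0 on ℝ², then u(x,t) := R(x,t) e^{iθ(x,t)} ũ( X(x,t), T(t) ) solves the radial variable coefficient equation i u_t + u_xx + ((n−1)/x) u_x + g(x,t)|u|²u + q(x,t)|u|⁴u + h(x,t) u = 0 on {(x,t) : x > 0}. -/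
open Complex

theorem aux_rpow_half {f : ℝ → ℝ} {ρ x : ℝ} (hf : HasDerivAt f (ρ * f x) x) (hpos : 0 < f x) :
    HasDerivAt (fun y => (f y) ^ ((1 : ℝ) / 2)) (ρ / 2 * (f x) ^ ((1 : ℝ) / 2)) x := by
  have h1 := hf.sqrt hpos.ne'
  simp only [← Real.sqrt_eq_rpow]
  convert h1 using 1
  have h2 : Real.sqrt (f x) ≠ 0 := (Real.sqrt_pos.2 hpos).ne'
  have h3 : f x = Real.sqrt (f x) ^ 2 := (Real.sq_sqrt hpos.le).symm
  field_simp
  rw [← h3]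

theorem aux_ofReal {f : ℝ → ℝ} {f' x : ℝ} (hf : HasDerivAt f f' x) :
    HasDerivAt (fun y => ((f y : ℝ) : ℂ)) ((f' : ℝ) : ℂ) x := hf.ofReal_comp

/-- derivative of amplitude times phase -/
theorem aux_amp {r φ : ℝ → ℝ} {ρ φ' x : ℝ} (hr : HasDerivAt r (ρ * r x) x)
    (hφ : HasDerivAt φ φ' x) :
    HasDerivAt (fun y => ((r y : ℝ) : ℂ) * Complex.exp (I * ((φ y : ℝ) : ℂ)))
      (((r x : ℝ) : ℂ) * Complex.exp (I * ((φ x : ℝ) : ℂ)) * ((ρ : ℂ) + I * φ')) x := by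
  have h1 := (aux_ofReal hr).mul (((aux_ofReal hφ).const_mul I).cexp)
  refine h1.congr_deriv ?_
  push_cast
  ring

theorem aux_curve {f : ℝ × ℝ → ℂ} (hf : Differentiable ℝ f) {c d : ℝ → ℝ} {c' d' x : ℝ}
    (hc : HasDerivAt c c' x) (hd : HasDerivAt d d' x) :
    HasDerivAt (fun y => f (c y, d y))
      ((c' : ℂ) * partialX f (c x, d x) + (d' : ℂ) * partialT f (c x, d x)) x := by
  have hF := (hf (c x, d x)).hasFDerivAt
  have key : ∀ {c d : ℝ → ℝ} {c' d' x : ℝ} (_ : HasDerivAt c c' x) (_ : HasDerivAt d d' x),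
      HasDerivAt (fun y => f (c y, d y)) (fderiv ℝ f (c x, d x) (c', d')) x := by
    intro c d c' d' x hc hd
    exact ((hf (c x, d x)).hasFDerivAt).comp_hasDerivAt x (hc.prodMk hd)
  have hX : partialX f (c x, d x) = fderiv ℝ f (c x, d x) (1, 0) := by
    unfold partialX
    exact (key (hasDerivAt_id (c x)) (hasDerivAt_const (c x) (d x))).deriv
  have hT : partialT f (c x, d x) = fderiv ℝ f (c x, d x) (0, 1) := by
    unfold partialT
    exact (key (hasDerivAt_const (d x) (c x)) (hasDerivAt_id (d x))).deriv
  have h2 : ((c', d') : ℝ × ℝ) = c' • ((1, 0) : ℝ × ℝ) + d' • ((0, 1) : ℝ × ℝ) := by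
    simp
  have h3 := key hc hd
  rw [h2, map_add, map_smul, map_smul, ← hX, ← hT] at h3
  simpa using h3

theorem aux_partialX_diff {f : ℝ × ℝ → ℂ} (hf : ContDiff ℝ 2 f) :
    Differentiable ℝ (partialX f) := by
  have hd : Differentiable ℝ f := hf.differentiable (by norm_num)
  have : partialX f = fun p => fderiv ℝ f p (1, 0) := by
    funext p
    unfold partialX
    have h1 := ((hd (p.1, p.2)).hasFDerivAt).comp_hasDerivAt p.1
      ((hasDerivAt_id p.1).prodMk (hasDerivAt_const p.1 p.2))
    exact h1.deriv
  rw [this]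
  have h2 : ContDiff ℝ 1 (fderiv ℝ f) := hf.fderiv_right (by norm_num)
  exact (h2.differentiable (by norm_num)).clm_apply (differentiable_const _)

theorem aux_potential (x s ε m γ' γ'' ξ' ξ'' η' Gt G' : ℝ) (hx : x ≠ 0) (hs : s ≠ 0)
    (hε : ε = -1 ∨ ε = 1) (hG : Gt ≠ 0) (L L' M : ℂ)
    (hL : L = (((-m / x / 2 : ℝ)) : ℂ)
      + I * ((-(γ' / (8 * s ^ 2)) * (2 * x) - ξ' / (2 * ε * s) : ℝ) : ℂ))
    (hL' : L' = ((m / x ^ 2 / 2 : ℝ) : ℂ) + I * ((-(γ' / (8 * s ^ 2)) * 2 : ℝ) : ℂ))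
    (hM : M = (((γ' / s ^ 2 - G' / Gt) / 2 : ℝ) : ℂ) + I * ((
        -((γ'' * s ^ 2 - γ' * γ') / (8 * s ^ 4)) * x ^ 2
        - (ξ'' * s - ξ' * (γ' / (2 * s))) / (2 * ε * s ^ 2) * x + η' : ℝ) : ℂ)) :
    I * M + L * L + L' + ((m / x : ℝ) : ℂ) * L
      + ((((3 / 16 * (γ' / s ^ 2) ^ 2 - γ'' / (8 * s ^ 2)) * x ^ 2
          + (1 / (2 * ε)) * ((ξ' * γ' - ξ'' * s ^ 2) / s ^ 3) * x
          + m * (m - 2) / (4 * x ^ 2)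
          + ξ' ^ 2 / (4 * s ^ 2) + η' : ℝ) : ℂ)
        + I * (((1 / 4) * (2 * G' / Gt - γ' / s ^ 2) : ℝ) : ℂ)) = 0 := by
  subst hL hL' hM
  apply Complex.ext
  · simp only [Complex.add_re, Complex.mul_re, Complex.add_im, Complex.mul_im, Complex.I_re,
      Complex.I_im, Complex.ofReal_re, Complex.ofReal_im, Complex.zero_re]
    rcases hε with rfl | rfl <;> field_simp <;> ring
  · simp only [Complex.add_re, Complex.mul_re, Complex.add_im, Complex.mul_im, Complex.I_re,
      Complex.I_im, Complex.ofReal_re, Complex.ofReal_im, Complex.zero_im]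
    rcases hε with rfl | rfl <;> field_simp <;> ring

/-- Explicit conditions on the coefficients of the radial CQNLS equation under which
    it is mapped by an equivalence transformation t̃ = T(t), x̃ = X(x,t), u = R e^{iθ} ũ
    to the standard constant coefficient cubic-quintic equation. -/
theorem radial_CQNLS_to_constant_coefficients
    (n : ℝ) (hn : 1 ≤ n) (ε : ℝ) (hε : ε = -1 ∨ ε = 1)
    (a₁ a₂ b₁ b₂ : ℝ) (ha₁ : a₁ ≠ 0)
    (γ G ξ η : ℝ → ℝ)
    (hγpos : ∀ t : ℝ, 0 < γ t) (haG : ∀ t : ℝ, 0 < a₁ * G t)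
    (hγ : ContDiff ℝ 2 γ) (hG : ContDiff ℝ 2 G) (hξ : ContDiff ℝ 2 ξ) (hη : ContDiff ℝ 2 η)
    (g q h : ℝ × ℝ → ℂ)
    (hg : ∀ p : ℝ × ℝ, 0 < p.1 →
      g p = ((G p.2 * p.1 ^ (n - 1) : ℝ) : ℂ) * (1 + I * ((a₂ / a₁ : ℝ) : ℂ)))
    (hq : ∀ p : ℝ × ℝ, 0 < p.1 →
      q p = (((b₁ : ℂ) + I * b₂) / ((a₁ ^ 2 : ℝ) : ℂ))
              * (((G p.2) ^ 2 * p.1 ^ (2 * (n - 1)) / γ p.2 : ℝ) : ℂ))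
    (hh : ∀ p : ℝ × ℝ, 0 < p.1 →
      h p = (((3 / 16 * (deriv γ p.2 / γ p.2) ^ 2 - deriv (deriv γ) p.2 / (8 * γ p.2)) * p.1 ^ 2
          + (1 / (2 * ε)) * ((deriv ξ p.2 * deriv γ p.2 - deriv (deriv ξ) p.2 * γ p.2)
              / (γ p.2 ^ ((3 : ℝ) / 2))) * p.1
          + (n - 1) * (n - 3) / (4 * p.1 ^ 2)
          + (deriv ξ p.2) ^ 2 / (4 * γ p.2) + deriv η p.2 : ℝ) : ℂ)
        + I * (((1 / 4) * (2 * deriv G p.2 / G p.2 - deriv γ p.2 / γ p.2) : ℝ) : ℂ))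
    (T : ℝ → ℝ) (hT : ∀ t : ℝ, T t = ∫ τ in (0 : ℝ)..t, γ τ)
    (X : ℝ × ℝ → ℝ) (hX : ∀ p : ℝ × ℝ, X p = ε * Real.sqrt (γ p.2) * p.1 + ξ p.2)
    (θ : ℝ × ℝ → ℝ)
    (hθ : ∀ p : ℝ × ℝ, θ p = -(deriv γ p.2 / (8 * γ p.2)) * p.1 ^ 2
        - (deriv ξ p.2 / (2 * ε * Real.sqrt (γ p.2))) * p.1 + η p.2)
    (R : ℝ × ℝ → ℝ)
    (hR : ∀ p : ℝ × ℝ, R p = (a₁ * γ p.2 / (G p.2 * p.1 ^ (n - 1))) ^ ((1 : ℝ) / 2))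
    (ut : ℝ × ℝ → ℂ) (hut : ContDiff ℝ 2 ut)
    (hsol : ∀ p : ℝ × ℝ,
      I * partialT ut p + partialX (partialX ut) p
        + ((a₁ : ℂ) + I * a₂) * (‖ut p‖ : ℂ) ^ 2 * ut p
        + ((b₁ : ℂ) + I * b₂) * (‖ut p‖ : ℂ) ^ 4 * ut p = 0)
    (u : ℝ × ℝ → ℂ)
    (hu : ∀ p : ℝ × ℝ,
      u p = ((R p : ℝ) : ℂ) * Complex.exp (I * ((θ p : ℝ) : ℂ)) * ut (X p, T p.2)) :
    ∀ p : ℝ × ℝ, 0 < p.1 →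
      I * partialT u p + partialX (partialX u) p
        + (((n - 1) / p.1 : ℝ) : ℂ) * partialX u p
        + g p * (‖u p‖ : ℂ) ^ 2 * u p + q p * (‖u p‖ : ℂ) ^ 4 * u p + h p * u p = 0 := by
  rintro ⟨x, t⟩ hx
  simp only at hx
  have hε0 : ε ≠ 0 := by rcases hε with rfl | rfl <;> norm_num
  have hε2 : ε ^ 2 = 1 := by rcases hε with rfl | rfl <;> norm_num
  have hG0 : ∀ t, G t ≠ 0 := fun t h0 => by have := haG t; rw [h0] at this; simp at this
  have hbase : ∀ y s : ℝ, 0 < y → 0 < a₁ * γ s / (G s * y ^ (n - 1)) := by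
    intro y s hy
    have h1 : a₁ * γ s / (G s * y ^ (n - 1)) = (a₁ * G s) * γ s / (G s ^ 2 * y ^ (n - 1)) := by
      have := hG0 s
      have := (Real.rpow_pos_of_pos hy (n - 1)).ne'
      field_simp
    rw [h1]
    have := haG s
    have := hγpos s
    have := Real.rpow_pos_of_pos hy (n - 1)
    have := pow_pos (abs_pos.2 (hG0 s)) 2
    rw [sq_abs] at this
    positivity
  have dγ : ∀ s, HasDerivAt γ (deriv γ s) s := fun s =>
    (hγ.differentiable (by norm_num) s).hasDerivAt
  have dG : ∀ s, HasDerivAt G (deriv G s) s := fun s =>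
    (hG.differentiable (by norm_num) s).hasDerivAt
  have dξ : ∀ s, HasDerivAt ξ (deriv ξ s) s := fun s =>
    (hξ.differentiable (by norm_num) s).hasDerivAt
  have dη : ∀ s, HasDerivAt η (deriv η s) s := fun s =>
    (hη.differentiable (by norm_num) s).hasDerivAt
  have ddγ : ∀ s, HasDerivAt (deriv γ) (deriv (deriv γ) s) s := fun s =>
    ((hγ.differentiable_deriv_two) s).hasDerivAt
  have ddξ : ∀ s, HasDerivAt (deriv ξ) (deriv (deriv ξ) s) s := fun s =>
    ((hξ.differentiable_deriv_two) s).hasDerivAt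
  have dT : ∀ s, HasDerivAt T (γ s) s := by
    intro s
    rw [funext hT]
    exact intervalIntegral.integral_hasDerivAt_right (hγ.continuous.intervalIntegrable _ _)
      (hγ.continuous.stronglyMeasurableAtFilter _ _) hγ.continuous.continuousAt
  obtain ⟨s, hs, hsγ⟩ : ∃ s : ℝ, 0 < s ∧ Real.sqrt (γ t) = s :=
    ⟨_, Real.sqrt_pos.2 (hγpos t), rfl⟩
  have hγs : γ t = s ^ 2 := by rw [← hsγ, Real.sq_sqrt (hγpos t).le]
  have hs0 := hs.ne'
  have hut1 : Differentiable ℝ ut := hut.differentiable (by norm_num)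
  have hut2 := aux_partialX_diff hut
  -- space derivatives of the ingredients
  have dRx : ∀ y, 0 < y → HasDerivAt (fun y => R (y, t)) ((-(n - 1) / y / 2) * R (y, t)) y := by
    intro y hy
    simp only [hR]
    refine aux_rpow_half ?_ (hbase y t hy)
    have h1 := (Real.hasDerivAt_rpow_const (x := y) (p := n - 1) (Or.inl hy.ne'))
    have hP := (Real.rpow_pos_of_pos hy (n - 1)).ne'
    have h2 := (hasDerivAt_const y (a₁ * γ t)).div (h1.const_mul (G t))
      (mul_ne_zero (hG0 t) hP)
    refine h2.congr_deriv ?_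
    rw [Real.rpow_sub_one hy.ne' (n - 1)]
    have := hG0 t
    field_simp
    ring
  have dθx : ∀ y, HasDerivAt (fun y => θ (y, t))
      (-(deriv γ t / (8 * s ^ 2)) * (2 * y) - deriv ξ t / (2 * ε * s)) y := by
    intro y
    simp only [hθ, hsγ]
    rw [hγs]
    have h1 := ((((hasDerivAt_id y).pow 2).const_mul (-(deriv γ t / (8 * s ^ 2)))).sub
      ((hasDerivAt_id y).const_mul (deriv ξ t / (2 * ε * s)))).add_const (η t)
    refine h1.congr_deriv ?_
    simp
  have dXx : ∀ y, HasDerivAt (fun y => X (y, t)) (ε * s) y := by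
    intro y
    simp only [hX, hsγ]
    have h1 := ((hasDerivAt_id y).const_mul (ε * s)).add_const (ξ t)
    refine h1.congr_deriv ?_
    simp
  set A : ℝ → ℂ := fun y => ((R (y, t) : ℝ) : ℂ) * Complex.exp (I * ((θ (y, t) : ℝ) : ℂ)) with hA
  set L : ℝ → ℂ := fun y => ((-(n - 1) / y / 2 : ℝ) : ℂ)
      + I * ((-(deriv γ t / (8 * s ^ 2)) * (2 * y) - deriv ξ t / (2 * ε * s) : ℝ) : ℂ) with hL
  have dA : ∀ y, 0 < y → HasDerivAt A (A y * L y) y := fun y hy => aux_amp (dRx y hy) (dθx y)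
  have dw : ∀ y, HasDerivAt (fun y => ut (X (y, t), T t))
      (((ε * s : ℝ) : ℂ) * partialX ut (X (y, t), T t)) y := by
    intro y
    simpa using aux_curve hut1 (dXx y) (hasDerivAt_const y (T t))
  have dw1 : ∀ y, HasDerivAt (fun y => partialX ut (X (y, t), T t))
      (((ε * s : ℝ) : ℂ) * partialX (partialX ut) (X (y, t), T t)) y := by
    intro y
    simpa using aux_curve hut2 (dXx y) (hasDerivAt_const y (T t))
  have dL : HasDerivAt L (((n - 1) / x ^ 2 / 2 : ℝ) + I * ((-(deriv γ t / (8 * s ^ 2)) * 2 : ℝ) : ℂ)) x := by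
    have h1 : HasDerivAt (fun y : ℝ => -(n - 1) / y / 2) ((n - 1) / x ^ 2 / 2) x := by
      have := ((hasDerivAt_const x (-(n - 1))).div (hasDerivAt_id x) hx.ne').div_const 2
      refine this.congr_deriv ?_
      simp
    have h2 : HasDerivAt (fun y : ℝ => -(deriv γ t / (8 * s ^ 2)) * (2 * y)
        - deriv ξ t / (2 * ε * s)) (-(deriv γ t / (8 * s ^ 2)) * 2) x := by
      have := (((hasDerivAt_id x).const_mul 2).const_mul (-(deriv γ t / (8 * s ^ 2)))).sub_const
        (deriv ξ t / (2 * ε * s))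
      refine this.congr_deriv ?_
      simp
    exact (aux_ofReal h1).add ((aux_ofReal h2).const_mul I)
  set k : ℂ := ((ε * s : ℝ) : ℂ) with hk
  have ux : ∀ y, 0 < y → partialX u (y, t) = A y * (L y * ut (X (y, t), T t)
      + k * partialX ut (X (y, t), T t)) := by
    intro y hy
    unfold partialX
    have h1 := (dA y hy).mul (dw y)
    have h2 : (fun y => u (y, t)) = fun y => A y * ut (X (y, t), T t) := by
      funext y; rw [hu]
    simp only [h2]
    refine h1.deriv.trans ?_
    unfold partialX
    ring
  have uxx : partialX (partialX u) (x, t) = A x * (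
      L x * (L x * ut (X (x, t), T t) + k * partialX ut (X (x, t), T t))
      + ((((n - 1) / x ^ 2 / 2 : ℝ) : ℂ) + I * ((-(deriv γ t / (8 * s ^ 2)) * 2 : ℝ) : ℂ))
          * ut (X (x, t), T t)
      + L x * (k * partialX ut (X (x, t), T t))
      + k * (k * partialX (partialX ut) (X (x, t), T t))) := by
    have h1 := (dA x hx).mul ((dL.mul (dw x)).add ((dw1 x).const_mul k))
    have h2 : (fun y => partialX u (y, t)) =ᶠ[nhds x] fun y => A y * (L y * ut (X (y, t), T t)
      + k * partialX ut (X (y, t), T t)) := by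
      filter_upwards [lt_mem_nhds hx] with y hy using ux y hy
    have h3 : partialX (partialX u) (x, t) = deriv (fun y => partialX u (y, t)) x := rfl
    rw [h3, h2.deriv_eq]
    refine h1.deriv.trans ?_
    simp only [Pi.add_apply, Pi.mul_apply]
    ring
  -- time derivatives
  have dsq : HasDerivAt (fun r => Real.sqrt (γ r)) (deriv γ t / (2 * s)) t := by
    have := (dγ t).sqrt (hγpos t).ne'
    rwa [hsγ] at this
  have dRt : HasDerivAt (fun r => R (x, r))
      (((deriv γ t / s ^ 2 - deriv G t / G t) / 2) * R (x, t)) t := by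
    simp only [hR]
    refine aux_rpow_half (f := fun r => a₁ * γ r / (G r * x ^ (n - 1))) ?_ (hbase x t hx)
    have hP := (Real.rpow_pos_of_pos hx (n - 1)).ne'
    have h2 := ((dγ t).const_mul a₁).div ((dG t).mul_const (x ^ (n - 1)))
      (mul_ne_zero (hG0 t) hP)
    refine h2.congr_deriv ?_
    have := hG0 t
    rw [hγs]
    field_simp
  have dθt : HasDerivAt (fun r => θ (x, r))
      (-((deriv (deriv γ) t * s ^ 2 - deriv γ t * deriv γ t) / (8 * s ^ 4)) * x ^ 2
        - (deriv (deriv ξ) t * s - deriv ξ t * (deriv γ t / (2 * s))) / (2 * ε * s ^ 2) * x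
        + deriv η t) t := by
    simp only [hθ]
    have h1 := ((((ddγ t).div ((dγ t).const_mul 8)
      (mul_ne_zero (by norm_num) (hγpos t).ne')).neg.mul_const (x ^ 2)).sub
      (((ddξ t).div (dsq.const_mul (2 * ε))
        (by rw [hsγ]; exact mul_ne_zero (mul_ne_zero two_ne_zero hε0) hs0)).mul_const x)).add (dη t)
    refine h1.congr_deriv ?_
    rw [hsγ, hγs]
    field_simp
  have dXt : HasDerivAt (fun r => X (x, r)) (ε * (deriv γ t / (2 * s)) * x + deriv ξ t) t := by
    simp only [hX]
    exact ((dsq.const_mul ε).mul_const x).add (dξ t)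
  obtain ⟨M, hM⟩ : ∃ M : ℂ, M = (((deriv γ t / s ^ 2 - deriv G t / G t) / 2 : ℝ) : ℂ) + I * ((
      -((deriv (deriv γ) t * s ^ 2 - deriv γ t * deriv γ t) / (8 * s ^ 4)) * x ^ 2
        - (deriv (deriv ξ) t * s - deriv ξ t * (deriv γ t / (2 * s))) / (2 * ε * s ^ 2) * x
        + deriv η t : ℝ) : ℂ) := ⟨_, rfl⟩
  have hut' : partialT u (x, t) = A x * (M * ut (X (x, t), T t)
      + ((ε * (deriv γ t / (2 * s)) * x + deriv ξ t : ℝ) : ℂ) * partialX ut (X (x, t), T t)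
      + ((γ t : ℝ) : ℂ) * partialT ut (X (x, t), T t)) := by
    have h1 := (aux_amp dRt dθt).mul (aux_curve hut1 dXt (dT t))
    have h2 : (fun r => u (x, r)) = fun r => ((R (x, r) : ℝ) : ℂ)
        * Complex.exp (I * ((θ (x, r) : ℝ) : ℂ)) * ut (X (x, r), T r) := by
      funext r; rw [hu]
    have h3 : partialT u (x, t) = deriv (fun r => u (x, r)) t := rfl
    rw [h3, h2]
    refine h1.deriv.trans ?_
    rw [← hM]
    simp only [hA]
    ring
  -- nonlinear terms
  have huA : u (x, t) = A x * ut (X (x, t), T t) := by rw [hu]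
  have hPpos := Real.rpow_pos_of_pos hx (n - 1)
  have hR2 : R (x, t) ^ 2 = a₁ * γ t / (G t * x ^ (n - 1)) := by
    rw [hR, ← Real.sqrt_eq_rpow, Real.sq_sqrt (hbase x t hx).le]
  have hnorm : ‖u (x, t)‖ ^ 2 = a₁ * γ t / (G t * x ^ (n - 1)) * ‖ut (X (x, t), T t)‖ ^ 2 := by
    rw [huA, norm_mul, hA]
    simp only [norm_mul]
    rw [mul_comm I, Complex.norm_exp_ofReal_mul_I, Complex.norm_real, mul_one, mul_pow,
      Real.norm_eq_abs, sq_abs, hR2]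
  have hnormC : (‖u (x, t)‖ : ℂ) ^ 2
      = ((a₁ * γ t / (G t * x ^ (n - 1)) : ℝ) : ℂ) * (‖ut (X (x, t), T t)‖ : ℂ) ^ 2 := by
    exact_mod_cast congrArg (fun r : ℝ => (r : ℂ)) hnorm
  have hnl1 : g (x, t) * (‖u (x, t)‖ : ℂ) ^ 2
      = (γ t : ℂ) * (((a₁ : ℂ) + I * a₂) * (‖ut (X (x, t), T t)‖ : ℂ) ^ 2) := by
    rw [hg _ hx, hnormC]
    have e1 : (a₁ : ℂ) ≠ 0 := by exact_mod_cast ha₁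
    have e2 : (G t : ℂ) ≠ 0 := by exact_mod_cast hG0 t
    have e3 : ((x ^ (n - 1) : ℝ) : ℂ) ≠ 0 := by exact_mod_cast hPpos.ne'
    simp only [Complex.ofReal_mul, Complex.ofReal_div]
    field_simp
  have hnl2 : q (x, t) * (‖u (x, t)‖ : ℂ) ^ 4
      = (γ t : ℂ) * (((b₁ : ℂ) + I * b₂) * (‖ut (X (x, t), T t)‖ : ℂ) ^ 4) := by
    have h4 : (‖u (x, t)‖ : ℂ) ^ 4 = ((‖u (x, t)‖ : ℂ) ^ 2) ^ 2 := by ring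
    rw [hq _ hx, h4, hnormC]
    have e1 : (a₁ : ℂ) ≠ 0 := by exact_mod_cast ha₁
    have e2 : (G t : ℂ) ≠ 0 := by exact_mod_cast hG0 t
    have e3 : ((x ^ (n - 1) : ℝ) : ℂ) ≠ 0 := by exact_mod_cast hPpos.ne'
    have e4 : (γ t : ℂ) ≠ 0 := by exact_mod_cast (hγpos t).ne'
    have e5 : x ^ (2 * (n - 1)) = (x ^ (n - 1)) ^ 2 := by
      rw [mul_comm, Real.rpow_mul hx.le, Real.rpow_two]
    simp only [e5, Complex.ofReal_mul, Complex.ofReal_div, Complex.ofReal_pow]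
    field_simp
  -- potential
  have hpot := aux_potential x s ε (n - 1) (deriv γ t) (deriv (deriv γ) t) (deriv ξ t)
    (deriv (deriv ξ) t) (deriv η t) (G t) (deriv G t) hx.ne' hs0 hε (hG0 t) (L x) _ M rfl rfl hM
  have h32 : γ t ^ ((3 : ℝ) / 2) = s ^ 3 := by
    rw [hγs, ← Real.rpow_natCast, ← Real.rpow_natCast, ← Real.rpow_mul hs.le]
    norm_num
  have hh' := hh (x, t) hx
  simp only at hh'
  rw [h32, hγs, show n - 3 = n - 1 - 2 by ring] at hh'
  rw [← hh'] at hpot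
  -- transport terms
  have htr : I * ((ε * (deriv γ t / (2 * s)) * x + deriv ξ t : ℝ) : ℂ) + 2 * L x * k
      + (((n - 1) / x : ℝ) : ℂ) * k = 0 := by
    rw [hL, hk]
    apply Complex.ext
    · simp only [Complex.add_re, Complex.mul_re, Complex.add_im, Complex.mul_im, Complex.I_re,
        Complex.I_im, Complex.ofReal_re, Complex.ofReal_im, Complex.zero_re, Complex.re_ofNat,
        Complex.im_ofNat]
      field_simp
      ring
    · simp only [Complex.add_re, Complex.mul_re, Complex.add_im, Complex.mul_im, Complex.I_re,
        Complex.I_im, Complex.ofReal_re, Complex.ofReal_im, Complex.zero_im, Complex.re_ofNat,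
        Complex.im_ofNat]
      rcases hε with h0 | h0 <;> rw [h0] <;> field_simp <;> ring
  have hk2 : k * k = (γ t : ℂ) := by
    rw [hk, ← Complex.ofReal_mul, hγs]
    congr 1
    linear_combination s ^ 2 * hε2
  have hS := hsol (X (x, t), T t)
  rw [hnl1, hnl2, hut', uxx, ux x hx, huA]
  simp only
  linear_combination (A x * (γ t : ℂ)) * hS + (A x * ut (X (x, t), T t)) * hpot
    + (A x * partialX ut (X (x, t), T t)) * htr
    + (A x * partialX (partialX ut) (X (x, t), T t)) * hk2
end
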